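/- arXiv:0810.0674 — 3 statements merged into one kernel-verified Lean document; each statement's English description precedes it below -/
import Mathlib

section
/- Let G=(V,E) be a finite simple undirected graph with positive integer edge capacities c_e, and let S_1,…,S_k be commodities (finite sets of terminals, each terminal i located at a vertex r_i, with distinct terminals of the same commodity at distinct vertices). Suppose the instance admits a feasible LP solution, i.e., functions d_a : V×V → [0,1] for a=1,…,k with d_a(u,u)=0, d_a(u,v)=d_a(v,u), d_a(u,v) ≤ d_a(u,w)+d_a(w,v) for all u,v,w ∈ V, d_a(r_i,r_j) ≥ 1 for all distinct i,j ∈ S_a, and Σ_a d_a(u,v) ≤ c_e for every edge e={u,v}. Then there exist edge sets F_1,…,F_k ⊆ E such that for each a, every two distinct terminals of S_a lie in different connected components of the graph (V, E∖F_a), and every edge e belongs to at most 8c_e + 4 of the sets F_1,…,F_k. -/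
open Finset

/-- `C` separates `u` from `v`. -/
def Separates {V : Type} (C : Finset V) (u v : V) : Prop := ¬(u ∈ C ↔ v ∈ C)

instance {V : Type} [DecidableEq V] (C : Finset V) (u v : V) : Decidable (Separates C u v) :=
  inferInstanceAs (Decidable (¬(u ∈ C ↔ v ∈ C)))

/-- The total weight of the ordered pairs separated by `C`. -/
def cutWeight {V : Type} [Fintype V] [DecidableEq V] (y : V → V → ℝ) (C : Finset V) : ℝ :=
  ∑ u, ∑ v, if Separates C u v then y u v else 0

/-- One of the four quadrants determined by `X` and `Y` is empty. -/
def CrossFree {V : Type} (X Y : Finset V) : Prop :=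
  (∀ u, ¬(u ∈ X ∧ u ∈ Y)) ∨ (∀ u, ¬(u ∈ X ∧ u ∉ Y)) ∨
    (∀ u, ¬(u ∉ X ∧ u ∈ Y)) ∨ (∀ u, ¬(u ∉ X ∧ u ∉ Y))

/-- `C` is a cut of minimum weight among those separating `p` from `q`. -/
def IsMinCut {V : Type} [Fintype V] [DecidableEq V] (y : V → V → ℝ) (p q : V)
    (C : Finset V) : Prop :=
  Separates C p q ∧ ∀ D, Separates D p q → cutWeight y C ≤ cutWeight y D

section MinCuts

variable {V : Type} [Fintype V] [DecidableEq V]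

lemma cutWeight_nonneg {y : V → V → ℝ} (hy : ∀ u v, 0 ≤ y u v) (C : Finset V) :
    0 ≤ cutWeight y C :=
  sum_nonneg fun u _ => sum_nonneg fun v _ => by split_ifs <;> simp [hy]

lemma cutWeight_inter_add_union_lt {y : V → V → ℝ} (hy : ∀ u v, 0 < y u v) {X Y : Finset V}
    {u v : V} (hu : u ∈ X ∧ u ∉ Y) (hv : v ∉ X ∧ v ∈ Y) :
    cutWeight y (X ∩ Y) + cutWeight y (X ∪ Y) < cutWeight y X + cutWeight y Y := by
  simp only [cutWeight, ← sum_add_distrib]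
  have key : ∀ a b, ((if Separates (X ∩ Y) a b then y a b else 0) +
      if Separates (X ∪ Y) a b then y a b else 0) ≤
      (if Separates X a b then y a b else 0) + if Separates Y a b then y a b else 0 := by
    intro a b
    have := hy a b
    by_cases h1 : a ∈ X <;> by_cases h2 : b ∈ X <;> by_cases h3 : a ∈ Y <;>
      by_cases h4 : b ∈ Y <;> simp [Separates, h1, h2, h3, h4, this.le]
  refine sum_lt_sum (fun a _ => sum_le_sum fun b _ => key a b) ⟨u, mem_univ _, ?_⟩
  refine sum_lt_sum (fun b _ => key u b) ⟨v, mem_univ _, ?_⟩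
  have := hy u v
  simp [Separates, hu.1, hu.2, hv.1, hv.2, this]

lemma cutWeight_sdiff_add_sdiff_lt {y : V → V → ℝ} (hy : ∀ u v, 0 < y u v) {X Y : Finset V}
    {u v : V} (hu : u ∈ X ∧ u ∈ Y) (hv : v ∉ X ∧ v ∉ Y) :
    cutWeight y (X \ Y) + cutWeight y (Y \ X) < cutWeight y X + cutWeight y Y := by
  simp only [cutWeight, ← sum_add_distrib]
  have key : ∀ a b, ((if Separates (X \ Y) a b then y a b else 0) +
      if Separates (Y \ X) a b then y a b else 0) ≤
      (if Separates X a b then y a b else 0) + if Separates Y a b then y a b else 0 := by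
    intro a b
    have := hy a b
    by_cases h1 : a ∈ X <;> by_cases h2 : b ∈ X <;> by_cases h3 : a ∈ Y <;>
      by_cases h4 : b ∈ Y <;> simp [Separates, h1, h2, h3, h4, this.le]
  refine sum_lt_sum (fun a _ => sum_le_sum fun b _ => key a b) ⟨u, mem_univ _, ?_⟩
  refine sum_lt_sum (fun b _ => key u b) ⟨v, mem_univ _, ?_⟩
  have := hy u v
  simp [Separates, hu.1, hu.2, hv.1, hv.2, this]

/-- For positive weights, minimum cuts of pairs of vertices never cross. -/
lemma IsMinCut.crossFree {y : V → V → ℝ} (hy : ∀ u v, 0 < y u v) {X Y : Finset V}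
    {p q p' q' : V} (hX : IsMinCut y p q X) (hY : IsMinCut y p' q' Y) : CrossFree X Y := by
  by_contra hcross
  simp only [CrossFree, not_or, not_forall, not_not] at hcross
  obtain ⟨⟨u₁, h₁⟩, ⟨u₂, h₂⟩, ⟨u₃, h₃⟩, ⟨u₄, h₄⟩⟩ := hcross
  have hI := cutWeight_inter_add_union_lt hy h₂ h₃
  have hD := cutWeight_sdiff_add_sdiff_lt hy h₁ h₄
  obtain ⟨hXs, hX⟩ := hX
  obtain ⟨hYs, hY⟩ := hY
  have a₁ := hX (X ∩ Y)
  have a₂ := hX (X ∪ Y)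
  have a₃ := hX (X \ Y)
  have a₄ := hX (Y \ X)
  have a₅ := hX Y
  have b₁ := hY (X ∩ Y)
  have b₂ := hY (X ∪ Y)
  have b₃ := hY (X \ Y)
  have b₄ := hY (Y \ X)
  have b₅ := hY X
  clear hX hY
  by_cases c₁ : p ∈ X <;> by_cases c₂ : q ∈ X <;> by_cases c₃ : p' ∈ Y <;>
    by_cases c₄ : q' ∈ Y <;> simp only [Separates, c₁, c₂, c₃, c₄, not_true_eq_false] at hXs hYs <;>
    by_cases c₅ : p ∈ Y <;> by_cases c₆ : q ∈ Y <;> by_cases c₇ : p' ∈ X <;>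
    by_cases c₈ : q' ∈ X <;>
    simp [Separates, c₁, c₂, c₃, c₄, c₅, c₆, c₇, c₈] at a₁ a₂ a₃ a₄ a₅ b₁ b₂ b₃ b₄ b₅ <;>
    linarith

lemma exists_isMinCut (y : V → V → ℝ) {p q : V} (h : p ≠ q) : ∃ C, IsMinCut y p q C := by
  have hne : (univ.filter fun C : Finset V => Separates C p q).Nonempty :=
    ⟨{p}, mem_filter.2 ⟨mem_univ _, by simp [Separates, h.symm]⟩⟩
  obtain ⟨C, hC, hmin⟩ := exists_min_image _ (cutWeight y) hne
  exact ⟨C, (mem_filter.1 hC).2, fun D hD => hmin D (by simpa using hD)⟩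

end MinCuts

section Signature

variable {V : Type} [DecidableEq V]

/-- The number of classes into which the cuts in `H` divide `R`. -/
def numClasses (R : Finset V) (H : Finset (Finset V)) : ℕ :=
  (R.image fun u => H.filter fun C => u ∈ C).card

lemma filter_mem_eq_iff {H : Finset (Finset V)} {u v : V} :
    (H.filter fun C => u ∈ C) = (H.filter fun C => v ∈ C) ↔ ∀ C ∈ H, ¬Separates C u v := by
  simp only [Finset.ext_iff, mem_filter, Separates, not_not]
  exact ⟨fun h C hC => by simpa [hC] using h C, fun h C => by
    by_cases hC : C ∈ H <;> simp [hC, h]⟩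

lemma numClasses_insert_le {R : Finset V} {H : Finset (Finset V)} {C : Finset V}
    (hC : ∀ D ∈ H, CrossFree C D) : numClasses R (insert C H) ≤ numClasses R H + 1 := by
  set σ : V → Finset (Finset V) := fun u => H.filter fun D => u ∈ D with hσ
  set τ : V → Finset (Finset V) := fun u => (insert C H).filter fun D => u ∈ D with hτ
  have hτσ : ∀ u v, τ u = τ v ↔ σ u = σ v ∧ ¬Separates C u v := by
    intro u v
    simp only [hσ, hτ, filter_mem_eq_iff, mem_insert, forall_eq_or_imp]
    tauto
  have hσs : ∀ u v, σ u ≠ σ v → ∃ D ∈ H, Separates D u v := by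
    intro u v h
    by_contra h'
    push Not at h'
    exact h (filter_mem_eq_iff.2 h')
  have hσm : ∀ u v, σ u = σ v → ∀ D ∈ H, (u ∈ D ↔ v ∈ D) := by
    intro u v h D hD
    have := filter_mem_eq_iff.1 h D hD
    simpa [Separates] using this
  have huniq : ∀ p p' q q', σ p = σ p' → σ q = σ q' → p ∈ C → p' ∉ C → q ∈ C → q' ∉ C →
      σ p = σ q := by
    intro p p' q q' hp hq h1 h2 h3 h4
    by_contra hne
    obtain ⟨D, hD, hs⟩ := hσs _ _ hne
    have e1 := hσm _ _ hp D hD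
    have e2 := hσm _ _ hq D hD
    have := hC D hD
    simp only [CrossFree] at this
    simp only [Separates] at hs
    rcases this with h | h | h | h <;>
      [have f1 := h p; have f1 := h p; have f1 := h p'; have f1 := h p'] <;>
      [have f2 := h q; have f2 := h q; have f2 := h q'; have f2 := h q'] <;> tauto
  have hcard : ∀ X ⊆ R, (∀ u ∈ X, ∀ v ∈ X, σ u = σ v → τ u = τ v) →
      (X.image τ).card ≤ (R.image σ).card := by
    intro X hX h
    refine card_le_card_of_injOn (fun s => s.filter fun D => D ∈ H) ?_ ?_
    · intro s hs
      simp only [coe_image, Set.mem_image, mem_coe] at hs ⊢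
      obtain ⟨u, hu, rfl⟩ := hs
      exact ⟨u, hX hu, by ext D; simp [hσ, hτ]; tauto⟩
    · intro s hs t ht hst
      simp only [coe_image, Set.mem_image, mem_coe] at hs ht
      obtain ⟨u, hu, rfl⟩ := hs
      obtain ⟨v, hv, rfl⟩ := ht
      refine h u hu v hv ?_
      ext D
      have := Finset.ext_iff.1 hst D
      simp [hτ, hσ] at this ⊢
      tauto
  change (R.image τ).card ≤ (R.image σ).card + 1
  by_cases hsplit : ∃ p ∈ R, ∃ p' ∈ R, σ p = σ p' ∧ p ∈ C ∧ p' ∉ C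
  · obtain ⟨p, hp, p', hp', hpp, hpC, hpC'⟩ := hsplit
    have main : ∀ u v, τ u ≠ τ p → σ u = σ v → u ∈ C → v ∉ C → False := by
      intro u v hu huv h1 h2
      have := huniq p p' u v hpp huv hpC hpC' h1 h2
      exact hu ((hτσ _ _).2 ⟨this.symm, by simp [Separates, h1, hpC]⟩)
    have hle : ((R.image τ).erase (τ p)).card ≤ (R.image σ).card := by
      have hsub : (R.image τ).erase (τ p) = (R.filter fun u => τ u ≠ τ p).image τ := by
        ext s
        simp only [mem_erase, mem_image, mem_filter]
        constructor
        · rintro ⟨h, u, hu, rfl⟩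
          exact ⟨u, ⟨hu, h⟩, rfl⟩
        · rintro ⟨u, ⟨hu, h⟩, rfl⟩
          exact ⟨h, u, hu, rfl⟩
      rw [hsub]
      refine hcard _ (filter_subset _ _) fun u hu v hv huv => ?_
      rw [mem_filter] at hu hv
      refine (hτσ _ _).2 ⟨huv, fun hs => ?_⟩
      by_cases h1 : u ∈ C
      · exact main u v hu.2 huv h1 fun h2 => hs (by simp [h1, h2])
      · exact main v u hv.2 huv.symm (by by_contra h2; exact hs (by simp [h1, h2])) h1
    have := pred_card_le_card_erase (s := R.image τ) (a := τ p)
    omega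
  · push Not at hsplit
    refine le_trans (hcard R subset_rfl fun u hu v hv huv => ?_) (Nat.le_succ _)
    have h1 := hsplit u hu v hv huv
    have h2 := hsplit v hv u hu huv.symm
    exact (hτσ _ _).2 ⟨huv, by simp only [Separates]; tauto⟩

end Signature

section Signature

variable {V : Type} [DecidableEq V]

lemma numClasses_empty_le (R : Finset V) : numClasses R ∅ ≤ 1 := by
  have : (R.image fun u => (∅ : Finset (Finset V)).filter fun C => u ∈ C) ⊆ {∅} := by
    intro s hs
    obtain ⟨u, _, rfl⟩ := mem_image.1 hs
    simp
  simpa [numClasses] using card_le_card this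

lemma numClasses_union_le {R : Finset V} {H : Finset (Finset V)} (K : Finset (Finset V))
    (h : ∀ C ∈ K, ∀ D ∈ H ∪ K, CrossFree C D) :
    numClasses R (H ∪ K) ≤ numClasses R H + K.card := by
  induction K using Finset.induction_on with
  | empty => simp
  | insert C K hC ih =>
    have h1 := ih fun X hX D hD => h X (mem_insert_of_mem hX) D (by
      rw [union_insert]; exact mem_insert_of_mem hD)
    have h2 := numClasses_insert_le (R := R) (H := H ∪ K) (C := C)
      fun D hD => h C (mem_insert_self _ _) D (by
        rw [union_insert]; exact mem_insert_of_mem hD)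
    rw [union_insert, card_insert_of_notMem hC]
    omega

lemma numClasses_le_card_add_one {R : Finset V} {H : Finset (Finset V)}
    (h : ∀ C ∈ H, ∀ D ∈ H, CrossFree C D) : numClasses R H ≤ H.card + 1 := by
  have h1 := numClasses_union_le (R := R) (H := ∅) H (by simpa using h)
  have h2 := numClasses_empty_le R
  rw [empty_union] at h1
  omega

lemma numClasses_eq_card {R : Finset V} {H : Finset (Finset V)}
    (h : ∀ p ∈ R, ∀ q ∈ R, p ≠ q → ∃ C ∈ H, Separates C p q) : numClasses R H = R.card := by
  refine card_image_of_injOn fun p hp q hq hpq => ?_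
  by_contra hne
  obtain ⟨C, hC, hs⟩ := h p hp q hq hne
  exact filter_mem_eq_iff.1 hpq C hC hs

lemma exists_ne_of_numClasses_lt {R : Finset V} {H : Finset (Finset V)}
    (h : numClasses R H < R.card) :
    ∃ p ∈ R, ∃ q ∈ R, p ≠ q ∧ ∀ C ∈ H, ¬Separates C p q := by
  obtain ⟨p, hp, q, hq, hne, heq⟩ := exists_ne_map_eq_of_card_lt_of_maps_to h
    (fun u hu => mem_image_of_mem (fun u => H.filter fun C => u ∈ C) hu)
  exact ⟨p, hp, q, hq, hne, filter_mem_eq_iff.1 heq⟩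

lemma numClasses_insert_vertex_le (R : Finset V) (H : Finset (Finset V)) (i : V) :
    numClasses (insert i R) H ≤ numClasses R H + 1 := by
  rw [numClasses, image_insert]
  exact card_insert_le _ _

lemma numClasses_insert_vertex_of_not_separates {R : Finset V} {H : Finset (Finset V)} {i j : V}
    (hj : j ∈ R) (h : ∀ C ∈ H, ¬Separates C i j) :
    numClasses (insert i R) H = numClasses R H := by
  rw [numClasses, image_insert, filter_mem_eq_iff.2 h, insert_eq_of_mem]
  · rfl
  · exact mem_image_of_mem (fun u => H.filter fun C => u ∈ C) hj

lemma Separates.symm {C : Finset V} {u v : V} (h : Separates C u v) : Separates C v u := by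
  simp only [Separates] at *
  tauto

end Signature

section Trees

variable {V : Type} [Fintype V] [DecidableEq V]

/-- A set of vertices is spanned by a tree of pairs whose minimum cuts separate all of its
elements. -/
lemma exists_tree_of_isMinCut {y : V → V → ℝ} (hy : ∀ u v, 0 < y u v) {M : V → V → Finset V}
    (hM : ∀ p q, p ≠ q → IsMinCut y p q (M p q)) (R : Finset V) (hR : R.Nonempty) :
    ∃ T : Finset (V × V), T.card + 1 = R.card ∧ (∀ e ∈ T, e.1 ∈ R ∧ e.2 ∈ R ∧ e.1 ≠ e.2) ∧
      (∀ H : Finset (Finset V),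
        (T.filter fun e => ∀ C ∈ H, ¬Separates C e.1 e.2).card + numClasses R H ≤ R.card) ∧
      ∀ p ∈ R, ∀ q ∈ R, p ≠ q → ∃ e ∈ T, Separates (M e.1 e.2) p q := by
  induction hR using Finset.Nonempty.cons_induction with
  | singleton a =>
    refine ⟨∅, by simp, by simp, fun H => by simp [numClasses], ?_⟩
    intro p hp q hq h
    simp only [mem_singleton] at hp hq
    exact absurd (hp.trans hq.symm) h
  | cons i R hi hR ih =>
    obtain ⟨T, hcard, hmem, hforest, hsep⟩ := ih
    rw [cons_eq_insert]
    set K := T.image fun e => M e.1 e.2 with hK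
    have hKcross : ∀ C ∈ K, ∀ D ∈ K, CrossFree C D := by
      intro C hC D hD
      obtain ⟨e, he, rfl⟩ := mem_image.1 hC
      obtain ⟨e', he', rfl⟩ := mem_image.1 hD
      exact (hM _ _ (hmem e he).2.2).crossFree hy (hM _ _ (hmem e' he').2.2)
    have hlt : numClasses (insert i R) K < (insert i R).card := by
      have h1 := numClasses_le_card_add_one (R := insert i R) hKcross
      have h2 : K.card ≤ T.card := card_image_le
      rw [card_insert_of_notMem hi]
      omega
    obtain ⟨j, hj, hij⟩ : ∃ j ∈ R, ∀ C ∈ K, ¬Separates C i j := by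
      obtain ⟨p, hp, q, hq, hne, h⟩ := exists_ne_of_numClasses_lt hlt
      rcases mem_insert.1 hp with rfl | hp'
      · exact ⟨q, (mem_insert.1 hq).resolve_left hne.symm, h⟩
      · rcases mem_insert.1 hq with rfl | hq
        · exact ⟨p, hp', fun C hC hs => h C hC hs.symm⟩
        · obtain ⟨e, he, hs⟩ := hsep p hp' q hq hne
          exact absurd hs (h _ (mem_image_of_mem _ he))
    have hine : i ≠ j := fun h => hi (h ▸ hj)
    have hnew : (i, j) ∉ T := fun h => hi (hmem _ h).1
    have hsep' : ∀ q ∈ R, ∃ e ∈ insert (i, j) T, Separates (M e.1 e.2) i q := by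
      intro q hq
      by_cases hqj : q = j
      · exact ⟨(i, j), mem_insert_self _ _, hqj ▸ (hM i j hine).1⟩
      · obtain ⟨e, he, hs⟩ := hsep j hj q hq (Ne.symm hqj)
        have := hij _ (mem_image_of_mem _ he)
        refine ⟨e, mem_insert_of_mem he, ?_⟩
        simp only [Separates] at *
        tauto
    refine ⟨insert (i, j) T, ?_, ?_, ?_, ?_⟩
    · rw [card_insert_of_notMem hnew, card_insert_of_notMem hi, hcard]
    · intro e he
      rcases mem_insert.1 he with rfl | he
      · exact ⟨mem_insert_self _ _, mem_insert_of_mem hj, hine⟩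
      · exact ⟨mem_insert_of_mem (hmem e he).1, mem_insert_of_mem (hmem e he).2.1, (hmem e he).2.2⟩
    · intro H
      have := hforest H
      rw [filter_insert, card_insert_of_notMem hi]
      split_ifs with h
      · rw [numClasses_insert_vertex_of_not_separates hj h,
          card_insert_of_notMem fun h => hnew (mem_of_mem_filter _ h)]
        omega
      · have := numClasses_insert_vertex_le R H i
        omega
    · intro p hp q hq hne
      rcases mem_insert.1 hp with rfl | hp'
      · exact hsep' q ((mem_insert.1 hq).resolve_left hne.symm)
      · rcases mem_insert.1 hq with rfl | hq
        · obtain ⟨e, he, hs⟩ := hsep' p hp'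
          exact ⟨e, he, hs.symm⟩
        · obtain ⟨e, he, hs⟩ := hsep p hp' q hq hne
          exact ⟨e, mem_insert_of_mem he, hs⟩

/-- A cross-free family of fewer than `#R` cuts which separates all elements of `R`. -/
def IsSepFamily (R : Finset V) (B : Finset (Finset V)) : Prop :=
  (∀ X ∈ B, ∀ Y ∈ B, CrossFree X Y) ∧ B.card ≤ R.card - 1 ∧
    ∀ p ∈ R, ∀ q ∈ R, p ≠ q → ∃ C ∈ B, Separates C p q

/-- A separating family of minimum total weight consists of minimum cuts. -/
lemma IsSepFamily.isMinCut_of_minimal {y : V → V → ℝ} (hy : ∀ u v, 0 < y u v) {R : Finset V}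
    {B : Finset (Finset V)} (hB : IsSepFamily R B)
    (hmin : ∀ B', IsSepFamily R B' → ∑ C ∈ B, cutWeight y C ≤ ∑ C ∈ B', cutWeight y C)
    {C : Finset V} (hC : C ∈ B) : ∃ p q, IsMinCut y p q C := by
  obtain ⟨hcross, hcard, hsep⟩ := hB
  have hRne : R.Nonempty := by
    have : 0 < B.card := card_pos.2 ⟨C, hC⟩
    exact card_pos.1 (by omega)
  have hex : ∀ p q : V, ∃ C, p ≠ q → IsMinCut y p q C := fun p q => by
    by_cases h : p = q
    · exact ⟨∅, fun h' => absurd h h'⟩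
    · exact (exists_isMinCut y h).imp fun C hC _ => hC
  choose M hM using hex
  obtain ⟨T, hTcard, hTmem, hforest, hTsep⟩ := exists_tree_of_isMinCut hy hM R hRne
  have hnn : ∀ C : Finset V, 0 ≤ cutWeight y C := cutWeight_nonneg fun u v => (hy u v).le
  have hfam : IsSepFamily R (T.image fun e => M e.1 e.2) := by
    refine ⟨?_, ?_, ?_⟩
    · intro X hX Y hY
      obtain ⟨e, he, rfl⟩ := mem_image.1 hX
      obtain ⟨e', he', rfl⟩ := mem_image.1 hY
      exact (hM _ _ (hTmem e he).2.2).crossFree hy (hM _ _ (hTmem e' he').2.2)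
    · exact card_image_le.trans (by omega)
    · intro p hp q hq h
      obtain ⟨e, he, hs⟩ := hTsep p hp q hq h
      exact ⟨_, mem_image_of_mem _ he, hs⟩
  have hle₁ : ∑ C ∈ B, cutWeight y C ≤ ∑ e ∈ T, cutWeight y (M e.1 e.2) :=
    (hmin _ hfam).trans (sum_image_le_of_nonneg fun _ _ => hnn _)
  have hall : ∀ A : Finset T, A.card ≤
      (A.biUnion fun e => B.filter fun C => Separates C e.1.1 e.1.2).card := by
    intro A
    set N := A.biUnion fun e => B.filter fun C => Separates C e.1.1 e.1.2 with hN
    have hNB : N ⊆ B := biUnion_subset.2 fun e _ => filter_subset _ _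
    have h1 := hforest (B \ N)
    have h2 : A.card ≤ (T.filter fun e => ∀ C ∈ B \ N, ¬Separates C e.1 e.2).card := by
      rw [← card_map (Function.Embedding.subtype (· ∈ T))]
      refine card_le_card fun e he => ?_
      obtain ⟨e', he', rfl⟩ := mem_map.1 he
      refine mem_filter.2 ⟨e'.2, fun C hC hs => (mem_sdiff.1 hC).2 ?_⟩
      exact mem_biUnion.2 ⟨e', he', mem_filter.2 ⟨(mem_sdiff.1 hC).1, hs⟩⟩
    have h3 := numClasses_union_le (R := R) (H := B \ N) N (by
      rw [sdiff_union_of_subset hNB]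
      exact fun X hX Y hY => hcross X (hNB hX) Y hY)
    rw [sdiff_union_of_subset hNB, numClasses_eq_card hsep] at h3
    omega
  obtain ⟨f, hfinj, hf⟩ := (all_card_le_biUnion_card_iff_exists_injective _).1 hall
  have hterm : ∀ e : T, cutWeight y (M e.1.1 e.1.2) ≤ cutWeight y (f e) := fun e =>
    (hM _ _ (hTmem _ e.2).2.2).2 _ (mem_filter.1 (hf e)).2
  have himg : univ.image f = B := by
    refine eq_of_subset_of_card_le (image_subset_iff.2 fun e _ => (mem_filter.1 (hf e)).1) ?_
    rw [card_image_of_injective _ hfinj, card_univ, Fintype.card_coe]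
    omega
  have hsum : ∑ e : T, cutWeight y (f e) = ∑ C ∈ B, cutWeight y C := by
    rw [← himg, sum_image fun a _ b _ h => hfinj h]
  have heq : ∑ e : T, cutWeight y (M e.1.1 e.1.2) = ∑ e : T, cutWeight y (f e) := by
    refine le_antisymm (sum_le_sum fun e _ => hterm e) ?_
    rw [hsum]
    refine hle₁.trans (le_of_eq ?_)
    exact (sum_coe_sort T fun e => cutWeight y (M e.1 e.2)).symm
  rw [sum_eq_sum_iff_of_le fun e _ => hterm e] at heq
  rw [← himg] at hC
  obtain ⟨e, _, rfl⟩ := mem_image.1 hC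
  refine ⟨e.1.1, e.1.2, (mem_filter.1 (hf e)).2, fun D hD => ?_⟩
  rw [← heq e (mem_univ _)]
  exact (hM _ _ (hTmem _ e.2).2.2).2 D hD

end Trees

section Balls

lemma sum_abs_truncation_sub_le {V : Type} {d : V → V → ℝ} (hd0 : ∀ u v, 0 ≤ d u v)
    (hsymm : ∀ u v, d u v = d v u) (htri : ∀ u v w, d u v ≤ d u w + d w v) {R : Finset V}
    (hR : ∀ p ∈ R, ∀ q ∈ R, p ≠ q → 1 ≤ d p q) (u v : V) :
    ∑ p ∈ R, |min (d p u) (1 / 2) - min (d p v) (1 / 2)| ≤ d u v := by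
  have huniq : ∀ w, ∀ p ∈ R, ∀ q ∈ R, d p w < 1 / 2 → d q w < 1 / 2 → p = q := by
    intro w p hp q hq h1 h2
    by_contra h
    linarith [hR p hp q hq h, htri p q w, hsymm q w]
  have hone : ∀ p, |min (d p u) (1 / 2) - min (d p v) (1 / 2)| ≤ d u v := by
    intro p
    refine (abs_min_sub_min_le_max _ _ _ _).trans ?_
    rw [sub_self, abs_zero, max_eq_left (abs_nonneg _), abs_sub_le_iff]
    constructor <;> linarith [htri p u v, htri p v u, hsymm u v]
  have hzero : ∀ p, ¬d p u < 1 / 2 → ¬d p v < 1 / 2 →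
      |min (d p u) (1 / 2) - min (d p v) (1 / 2)| = 0 := by
    intro p h1 h2
    rw [min_eq_right (not_lt.1 h1), min_eq_right (not_lt.1 h2), sub_self, abs_zero]
  by_cases hu : ∃ p ∈ R, d p u < 1 / 2
  · obtain ⟨p, hp, hpu⟩ := hu
    by_cases hv : ∃ q ∈ R, q ≠ p ∧ d q v < 1 / 2
    · obtain ⟨q, hq, hqp, hqv⟩ := hv
      rw [sum_eq_add p q hqp.symm (fun c hc h => hzero c
        (fun h' => h.1 (huniq u c hc p hp h' hpu)) (fun h' => h.2 (huniq v c hc q hq h' hqv)))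
        (fun h => absurd hp h) (fun h => absurd hq h)]
      have h1 : ¬d p v < 1 / 2 := fun h => hqp (huniq v q hq p hp hqv h)
      have h2 : ¬d q u < 1 / 2 := fun h => hqp (huniq u q hq p hp h hpu)
      rw [min_eq_left hpu.le, min_eq_right (not_lt.1 h1), min_eq_left hqv.le,
        min_eq_right (not_lt.1 h2), abs_of_neg (by linarith), abs_of_pos (by linarith)]
      linarith [hR p hp q hq hqp.symm, htri p q u, htri u q v, hsymm q v]
    · push Not at hv
      rw [sum_eq_single p (fun c hc h => hzero c (fun h' => h (huniq u c hc p hp h' hpu))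
        (hv c hc h).not_gt) (fun h => absurd hp h)]
      exact hone p
  · push Not at hu
    by_cases hv : ∃ q ∈ R, d q v < 1 / 2
    · obtain ⟨q, hq, hqv⟩ := hv
      rw [sum_eq_single q (fun c hc h => hzero c (hu c hc).not_gt
        (fun h' => h (huniq v c hc q hq h' hqv))) (fun h => absurd hq h)]
      exact hone q
    · push Not at hv
      rw [sum_eq_zero fun c hc => hzero c (hu c hc).not_gt (hv c hc).not_gt]
      exact hd0 u v

variable {V : Type} [Fintype V] [DecidableEq V]

/-- Some sublevel set of `x` is cheap: average the cut weight over the levels in `(0, 1/2]`. -/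
lemma exists_cutWeight_sublevel_le (y : V → V → ℝ) {x : V → ℝ} (hx : ∀ u, 0 ≤ x u) :
    ∃ ρ : ℝ, 0 < ρ ∧ ρ ≤ 1 / 2 ∧ cutWeight y (univ.filter fun u => x u < ρ) ≤
      2 * ∑ u, ∑ v, y u v * |min (x u) (1 / 2) - min (x v) (1 / 2)| := by
  have hind : ∀ ρ, cutWeight y (univ.filter fun u => x u < ρ) = ∑ u, ∑ v,
      (Set.Ioc (min (x u) (x v)) (max (x u) (x v))).indicator (fun _ => y u v) ρ := by
    intro ρ
    refine sum_congr rfl fun u _ => sum_congr rfl fun v _ => ?_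
    by_cases h1 : x u < ρ <;> by_cases h2 : x v < ρ <;>
      simp [Separates, Set.indicator, h1, h2, not_lt.1, not_le.2]
  have hint : ∀ u v, MeasureTheory.IntegrableOn
      ((Set.Ioc (min (x u) (x v)) (max (x u) (x v))).indicator fun _ => y u v)
      (Set.Ioc (0 : ℝ) (1 / 2)) := fun u v =>
    (MeasureTheory.integrableOn_const (by simp)).indicator measurableSet_Ioc
  have hval : ∀ u v, ∫ ρ in Set.Ioc (0 : ℝ) (1 / 2),
      (Set.Ioc (min (x u) (x v)) (max (x u) (x v))).indicator (fun _ => y u v) ρ =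
      y u v * |min (x u) (1 / 2) - min (x v) (1 / 2)| := by
    intro u v
    rw [MeasureTheory.integral_indicator_const _ measurableSet_Ioc,
      MeasureTheory.measureReal_restrict_apply measurableSet_Ioc, Set.Ioc_inter_Ioc,
      Real.volume_real_Ioc, smul_eq_mul, mul_comm]
    congr 1
    have h1 := hx u
    have h2 := hx v
    rcases le_total (x u) (x v) with h | h <;> rcases le_total (x u) (1 / 2) with h3 | h3 <;>
      rcases le_total (x v) (1 / 2) with h4 | h4 <;>
      simp only [min_eq_left, min_eq_right, max_eq_left, max_eq_right, h, h1, h2, h3, h4] <;>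
      grind
  obtain ⟨ρ, hρ, hle⟩ := MeasureTheory.exists_le_setAverage
    (μ := MeasureTheory.volume) (s := Set.Ioc (0 : ℝ) (1 / 2))
    (f := fun ρ => ∑ u, ∑ v,
      (Set.Ioc (min (x u) (x v)) (max (x u) (x v))).indicator (fun _ => y u v) ρ)
    (by simp) (by simp)
    (MeasureTheory.integrable_finsetSum _ fun u _ =>
      MeasureTheory.integrable_finsetSum _ fun v _ => hint u v)
  refine ⟨ρ, hρ.1, hρ.2, (hind ρ).trans_le (hle.trans (le_of_eq ?_))⟩
  rw [MeasureTheory.setAverage_eq, MeasureTheory.integral_finsetSum _ fun u _ =>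
    MeasureTheory.integrable_finsetSum _ fun v _ => hint u v]
  simp_rw [MeasureTheory.integral_finsetSum _ fun v _ => hint _ v, hval]
  norm_num [Real.volume_real_Ioc]

/-- A metric in which the elements of `R` are far apart yields a cheap separating family of
balls. -/
lemma exists_isSepFamily_le {y : V → V → ℝ} (hy : ∀ u v, 0 ≤ y u v) {d : V → V → ℝ}
    (hd0 : ∀ u v, 0 ≤ d u v) (hrefl : ∀ u, d u u = 0) (hsymm : ∀ u v, d u v = d v u)
    (htri : ∀ u v w, d u v ≤ d u w + d w v) {R : Finset V}
    (hR : ∀ p ∈ R, ∀ q ∈ R, p ≠ q → 1 ≤ d p q) :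
    ∃ B, IsSepFamily R B ∧ ∑ C ∈ B, cutWeight y C ≤ 2 * ∑ u, ∑ v, y u v * d u v := by
  rcases R.eq_empty_or_nonempty with rfl | ⟨p₀, hp₀⟩
  · refine ⟨∅, by simp [IsSepFamily], ?_⟩
    rw [sum_empty]
    exact mul_nonneg two_pos.le
      (sum_nonneg fun u _ => sum_nonneg fun v _ => mul_nonneg (hy u v) (hd0 u v))
  choose ρ hρ0 hρ1 hρ using fun p => exists_cutWeight_sublevel_le y (hd0 p)
  set ball : V → Finset V := fun p => univ.filter fun u => d p u < ρ p with hball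
  have hmem : ∀ p u, u ∈ ball p ↔ d p u < ρ p := fun p u => by simp [hball]
  have hself : ∀ p, p ∈ ball p := fun p => by rw [hmem, hrefl]; exact hρ0 p
  have hdisj : ∀ p ∈ R, ∀ q ∈ R, p ≠ q → ∀ u, ¬(u ∈ ball p ∧ u ∈ ball q) := by
    intro p hp q hq h u hu
    rw [hmem, hmem] at hu
    linarith [hR p hp q hq h, htri p q u, hsymm q u, hρ1 p, hρ1 q, hu.1, hu.2]
  have hnot : ∀ p ∈ R, ∀ q ∈ R, p ≠ q → q ∉ ball p := fun p hp q hq h hq' =>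
    hdisj p hp q hq h q ⟨hq', hself q⟩
  refine ⟨(R.erase p₀).image ball, ⟨?_, ?_, ?_⟩, ?_⟩
  · intro X hX Y hY
    obtain ⟨p, hp, rfl⟩ := mem_image.1 hX
    obtain ⟨q, hq, rfl⟩ := mem_image.1 hY
    by_cases h : p = q
    · subst h
      exact Or.inr (Or.inl fun u hu => hu.2 hu.1)
    · exact Or.inl (hdisj p (mem_of_mem_erase hp) q (mem_of_mem_erase hq) h)
  · exact card_image_le.trans (card_erase_of_mem hp₀).le
  · intro p hp q hq h
    by_cases hpp : p = p₀
    · refine ⟨ball q, mem_image_of_mem _ (mem_erase.2 ⟨fun h' => h (hpp.trans h'.symm), hq⟩), ?_⟩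
      have := hnot q hq p hp h.symm
      simp [Separates, hself q, this]
    · refine ⟨ball p, mem_image_of_mem _ (mem_erase.2 ⟨hpp, hp⟩), ?_⟩
      have := hnot p hp q hq h
      simp [Separates, hself p, this]
  · calc ∑ C ∈ (R.erase p₀).image ball, cutWeight y C
        ≤ ∑ p ∈ R.erase p₀, cutWeight y (ball p) :=
          sum_image_le_of_nonneg fun _ _ => cutWeight_nonneg hy _
      _ ≤ ∑ p ∈ R.erase p₀, 2 * ∑ u, ∑ v, y u v * |min (d p u) (1 / 2) - min (d p v) (1 / 2)| :=
          sum_le_sum fun p _ => hρ p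
      _ = 2 * ∑ u, ∑ v, y u v *
            ∑ p ∈ R.erase p₀, |min (d p u) (1 / 2) - min (d p v) (1 / 2)| := by
          rw [← mul_sum, sum_comm]
          congr 1
          refine sum_congr rfl fun u _ => ?_
          rw [sum_comm]
          exact sum_congr rfl fun v _ => (mul_sum _ _ _).symm
      _ ≤ 2 * ∑ u, ∑ v, y u v * d u v := by
          gcongr with u _ v _
          · exact hy u v
          · exact sum_abs_truncation_sub_le hd0 hsymm htri (fun p hp q hq => hR p
              (mem_of_mem_erase hp) q (mem_of_mem_erase hq)) u v

end Balls

lemma sq_max_zero_add_le (s δ : ℝ) :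
    max 0 (s + δ) ^ 2 ≤ max 0 s ^ 2 + 2 * max 0 s * δ + δ ^ 2 := by
  rcases max_cases 0 (s + δ) with ⟨h1, h2⟩ | ⟨h1, h2⟩ <;>
    rcases max_cases 0 s with ⟨h3, h4⟩ | ⟨h3, h4⟩ <;> rw [h1, h3] <;> nlinarith

lemma nonneg_of_forall_nonneg_add_mul {A B : ℝ} (hB : 0 ≤ B)
    (h : ∀ t, 0 < t → t ≤ 1 → 0 ≤ t * A + t ^ 2 * B) : 0 ≤ A := by
  by_contra hA
  push Not at hA
  have hpos : 0 < -A + B + 1 := by linarith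
  have h1 := h (-A / (-A + B + 1)) (div_pos (by linarith) hpos)
    ((div_le_one hpos).2 (by linarith))
  have h2 : -A / (-A + B + 1) * A + (-A / (-A + B + 1)) ^ 2 * B =
      A ^ 2 * (A - 1) / (-A + B + 1) ^ 2 := by
    field_simp
    ring
  rw [h2] at h1
  have : A ^ 2 * (A - 1) / (-A + B + 1) ^ 2 < 0 :=
    div_neg_of_neg_of_pos (mul_neg_of_pos_of_neg (by nlinarith) (by linarith)) (by positivity)
  linarith

/-- A distribution over `Ω` which nearly respects the bounds `b` in expectation and is supported on
minimizers of one positive linear functional. -/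
lemma exists_distribution_le {Ω I : Type} [Fintype Ω] [Nonempty Ω] [Fintype I]
    {W : Ω → I → ℝ} (hW : ∀ ω i, 0 ≤ W ω i) (J : I → Prop) (b : I → ℝ)
    (hyp : ∀ y : I → ℝ, (∀ i, 0 ≤ y i) → (∀ i, ¬J i → y i = 0) →
      ∃ ω, ∑ i, y i * W ω i ≤ ∑ i, y i * b i) :
    ∃ x : Ω → ℝ, (∀ ω, 0 ≤ x ω) ∧ ∑ ω, x ω = 1 ∧ ∃ y : I → ℝ, (∀ i, 0 < y i) ∧
      (∀ ω, x ω ≠ 0 → ∀ ω', ∑ i, y i * W ω i ≤ ∑ i, y i * W ω' i) ∧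
      ∀ i, J i → ∑ ω, x ω * W ω i ≤ b i + 1 / 2 := by
  classical
  set M := ∑ ω, ∑ i, W ω i with hM
  have hM0 : 0 ≤ M := sum_nonneg fun ω _ => sum_nonneg fun i _ => hW ω i
  set η : ℝ := 1 / (2 * (M + 1)) with hη
  have hη0 : 0 < η := by positivity
  have hηM : η * M ≤ 1 / 2 := by
    rw [hη, div_mul_eq_mul_div, div_le_div_iff₀ (by positivity) two_pos]
    linarith
  let L : (Ω → ℝ) → I → ℝ := fun x i => ∑ ω, x ω * W ω i
  let Ψ : (Ω → ℝ) → ℝ := fun x =>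
    ∑ i, ((if J i then max 0 (L x i - b i) ^ 2 else 0) + η * L x i)
  have hcont : Continuous Ψ := by
    refine continuous_finsetSum _ fun i _ => ?_
    have hL : Continuous fun x => L x i := by fun_prop
    split_ifs <;> fun_prop
  obtain ⟨ω₀⟩ := ‹Nonempty Ω›
  obtain ⟨x, hx, hxmin⟩ := (isCompact_stdSimplex ℝ Ω).exists_isMinOn
    ⟨Pi.single ω₀ 1, single_mem_stdSimplex ℝ ω₀⟩ hcont.continuousOn
  let z : I → ℝ := fun i => if J i then 2 * max 0 (L x i - b i) else 0
  have hz0 : ∀ i, 0 ≤ z i := fun i => by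
    simp only [z]
    split_ifs
    · positivity
    · rfl
  have hvar : ∀ x' ∈ stdSimplex ℝ Ω, ∑ i, (z i + η) * L x i ≤ ∑ i, (z i + η) * L x' i := by
    intro x' hx'
    rw [← sub_nonneg, ← sum_sub_distrib]
    refine nonneg_of_forall_nonneg_add_mul (B := ∑ i, (L x' i - L x i) ^ 2)
      (sum_nonneg fun i _ => sq_nonneg _) fun t ht0 ht1 => ?_
    have hmem : (1 - t) • x + t • x' ∈ stdSimplex ℝ Ω :=
      convex_stdSimplex ℝ Ω hx hx' (by linarith) ht0.le (by linarith)
    have hle : Ψ x ≤ Ψ ((1 - t) • x + t • x') := hxmin hmem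
    have hLt : ∀ i, L ((1 - t) • x + t • x') i = L x i + t * (L x' i - L x i) := by
      intro i
      simp only [L, Pi.add_apply, Pi.smul_apply, smul_eq_mul, ← sum_sub_distrib, mul_sum,
        ← sum_add_distrib]
      exact sum_congr rfl fun ω _ => by ring
    have hub : Ψ ((1 - t) • x + t • x') ≤ Ψ x + (t * ∑ i, ((z i + η) * L x' i - (z i + η) * L x i) +
        t ^ 2 * ∑ i, (L x' i - L x i) ^ 2) := by
      simp only [Ψ, hLt, mul_sum, ← sum_add_distrib]
      refine sum_le_sum fun i _ => ?_
      simp only [z]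
      split_ifs
      · have := sq_max_zero_add_le (L x i - b i) (t * (L x' i - L x i))
        rw [show L x i + t * (L x' i - L x i) - b i = L x i - b i + t * (L x' i - L x i) by ring]
        linarith
      · have := mul_nonneg (sq_nonneg t) (sq_nonneg (L x' i - L x i))
        linarith
    linarith
  have hpair : ∀ y : I → ℝ, ∑ i, y i * L x i = ∑ ω, x ω * ∑ i, y i * W ω i := by
    intro y
    simp only [L, mul_sum]
    rw [sum_comm]
    exact sum_congr rfl fun ω _ => sum_congr rfl fun i _ => by ring
  have hopt : ∀ ω', ∑ i, (z i + η) * L x i ≤ ∑ i, (z i + η) * W ω' i := by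
    intro ω'
    refine (hvar _ (single_mem_stdSimplex ℝ ω')).trans (le_of_eq ?_)
    simp [L, Pi.single_apply]
  refine ⟨x, hx.1, hx.2, fun i => z i + η, fun i => by linarith [hz0 i], ?_, ?_⟩
  · intro ω hω ω'
    by_contra! hlt
    obtain ⟨ω₁, -, hω₁⟩ := exists_min_image univ (fun ω => ∑ i, (z i + η) * W ω i)
      ⟨ω₀, mem_univ _⟩
    have hlt' : ∑ i, (z i + η) * W ω₁ i < ∑ i, (z i + η) * W ω i :=
      (hω₁ ω' (mem_univ _)).trans_lt hlt
    have h1 := hopt ω₁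
    rw [hpair] at h1
    have h2 : ∑ ω, x ω * ∑ i, (z i + η) * W ω₁ i < ∑ ω, x ω * ∑ i, (z i + η) * W ω i :=
      sum_lt_sum (fun ω _ => mul_le_mul_of_nonneg_left (hω₁ ω (mem_univ _)) (hx.1 ω))
        ⟨ω, mem_univ _, mul_lt_mul_of_pos_left hlt' (lt_of_le_of_ne (hx.1 ω) hω.symm)⟩
    rw [← sum_mul, hx.2, one_mul] at h2
    linarith
  · intro j hj
    obtain ⟨ω', hω'⟩ := hyp z hz0 fun i hi => if_neg hi
    have h1 := hopt ω'
    simp only [add_mul, sum_add_distrib, ← mul_sum] at h1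
    have h2 : 0 ≤ η * ∑ i, L x i := mul_nonneg hη0.le
      (sum_nonneg fun i _ => sum_nonneg fun ω _ => mul_nonneg (hx.1 ω) (hW ω i))
    have h3 : η * ∑ i, W ω' i ≤ η * M := mul_le_mul_of_nonneg_left
      (single_le_sum (f := fun ω => ∑ i, W ω i)
        (fun ω _ => sum_nonneg fun i _ => hW ω i) (mem_univ ω')) hη0.le
    have h4 : ∑ i, z i * (L x i - b i) ≤ 1 / 2 := by
      simp only [mul_sub, sum_sub_distrib]
      linarith
    have h5 : ∀ i, 0 ≤ z i * (L x i - b i) := by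
      intro i
      simp only [z]
      split_ifs
      · rcases max_cases 0 (L x i - b i) with ⟨h, h'⟩ | ⟨h, h'⟩ <;> rw [h] <;> nlinarith
      · simp
    have h6 := (single_le_sum (f := fun i => z i * (L x i - b i)) (fun i _ => h5 i)
      (mem_univ j)).trans h4
    simp only [z, if_pos hj] at h6
    change L x j ≤ b j + 1 / 2
    by_contra! hlt
    rw [max_eq_right (by linarith)] at h6
    nlinarith

section Weights

variable {V ι : Type} [Fintype V] [DecidableEq V] [Fintype ι]

/-- Metrics separating the sets `R a` can be replaced by weighted cross-free cuts, at the cost of a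
factor two and an additive error. -/
lemma exists_crossFree_weights (R : ι → Finset V) {d : ι → V → V → ℝ}
    (hd0 : ∀ a u v, 0 ≤ d a u v) (hrefl : ∀ a u, d a u u = 0)
    (hsymm : ∀ a u v, d a u v = d a v u) (htri : ∀ a u v w, d a u v ≤ d a u w + d a w v)
    (hR : ∀ a, ∀ p ∈ R a, ∀ q ∈ R a, p ≠ q → 1 ≤ d a p q) (J : V → V → Prop) (b : V → V → ℝ)
    (hJ : ∀ u v, J u v → ∑ a, d a u v ≤ b u v) :
    ∃ w : ι → Finset V → ℝ, (∀ a C, 0 ≤ w a C) ∧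
      (∀ a, ∀ p ∈ R a, ∀ q ∈ R a, p ≠ q → 1 ≤ ∑ C, if Separates C p q then w a C else 0) ∧
      (∀ a a' C C', w a C ≠ 0 → w a' C' ≠ 0 → CrossFree C C') ∧
      ∀ u v, J u v → ∑ a, ∑ C, (if Separates C u v then w a C else 0) ≤ 2 * b u v + 1 / 2 := by
  classical
  let Ω := ∀ a, {B // IsSepFamily (R a) B}
  have hex : ∀ y : V → V → ℝ, (∀ u v, 0 ≤ y u v) → ∃ ω : Ω,
      ∀ a, ∑ C ∈ (ω a).1, cutWeight y C ≤ 2 * ∑ u, ∑ v, y u v * d a u v := by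
    intro y hy
    choose B hB hBle using fun a =>
      exists_isSepFamily_le hy (hd0 a) (hrefl a) (hsymm a) (htri a) (hR a)
    exact ⟨fun a => ⟨B a, hB a⟩, hBle⟩
  have hne : Nonempty Ω := ⟨(hex 0 fun _ _ => le_rfl).choose⟩
  let W : Ω → V × V → ℝ := fun ω e => ∑ a, ∑ C ∈ (ω a).1, if Separates C e.1 e.2 then 1 else 0
  have hWy : ∀ (y : V × V → ℝ) (ω : Ω), ∑ e, y e * W ω e =
      ∑ a, ∑ C ∈ (ω a).1, cutWeight (fun u v => y (u, v)) C := by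
    intro y ω
    simp only [W, mul_sum]
    rw [sum_comm]
    refine sum_congr rfl fun a _ => ?_
    rw [sum_comm]
    refine sum_congr rfl fun C _ => ?_
    rw [cutWeight, Fintype.sum_prod_type]
    simp
  obtain ⟨x, hx0, hx1, y, hy, hmin, hload⟩ := exists_distribution_le (W := W)
    (fun ω e => sum_nonneg fun a _ => sum_nonneg fun C _ => by split_ifs <;> simp)
    (fun e => J e.1 e.2) (fun e => 2 * b e.1 e.2) (by
      intro y hy hyJ
      obtain ⟨ω, hω⟩ := hex (fun u v => y (u, v)) fun u v => hy _
      refine ⟨ω, ?_⟩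
      rw [hWy]
      refine (sum_le_sum fun a _ => hω a).trans ?_
      have hprod : ∀ a, ∑ u, ∑ v, y (u, v) * d a u v = ∑ e : V × V, y e * d a e.1 e.2 :=
        fun a => (Fintype.sum_prod_type fun e : V × V => y e * d a e.1 e.2).symm
      simp only [hprod]
      rw [← mul_sum, sum_comm, mul_sum]
      refine sum_le_sum fun e _ => ?_
      rw [← mul_sum]
      by_cases he : J e.1 e.2
      · have := mul_le_mul_of_nonneg_left (hJ _ _ he) (hy e)
        linarith
      · simp [hyJ e he])
  have hsupp : ∀ ω, x ω ≠ 0 → ∀ a, ∀ C ∈ (ω a).1, ∃ p q, IsMinCut (fun u v => y (u, v)) p q C := by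
    intro ω hω a C hC
    refine (ω a).2.isMinCut_of_minimal (fun u v => hy _) (fun B' hB' => ?_) hC
    have h := hmin ω hω (Function.update ω a ⟨B', hB'⟩)
    rw [hWy, hWy, ← add_sum_erase _ _ (mem_univ a), ← add_sum_erase _ _ (mem_univ a)] at h
    rw [Function.update_self] at h
    have hrest : ∀ a' ∈ univ.erase a, ∑ C ∈ (Function.update ω a ⟨B', hB'⟩ a').1,
        cutWeight (fun u v => y (u, v)) C = ∑ C ∈ (ω a').1, cutWeight (fun u v => y (u, v)) C := by
      intro a' ha'
      rw [Function.update_of_ne (ne_of_mem_erase ha')]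
    rw [sum_congr rfl hrest] at h
    linarith
  refine ⟨fun a C => ∑ ω, x ω * if C ∈ (ω a).1 then 1 else 0, ?_, ?_, ?_, ?_⟩
  · exact fun a C => sum_nonneg fun ω _ => mul_nonneg (hx0 ω) (by split_ifs <;> simp)
  · intro a p hp q hq hpq
    calc (1 : ℝ) = ∑ ω, x ω * 1 := by simp [hx1]
      _ ≤ ∑ ω, x ω * ∑ C, (if Separates C p q then if C ∈ (ω a).1 then (1 : ℝ) else 0 else 0) := by
          gcongr with ω _
          · exact hx0 ω
          · obtain ⟨C, hC, hs⟩ := (ω a).2.2.2 p hp q hq hpq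
            refine le_trans (le_of_eq ?_) (single_le_sum (f := fun C => if Separates C p q then
              if C ∈ (ω a).1 then (1 : ℝ) else 0 else 0)
              (fun C _ => by split_ifs <;> simp) (mem_univ C))
            simp [hs, hC]
      _ = _ := by
          simp only [mul_sum]
          rw [sum_comm]
          refine sum_congr rfl fun C _ => ?_
          split_ifs <;> simp
  · intro a a' C C' hC hC'
    obtain ⟨ω, -, hω⟩ := exists_ne_zero_of_sum_ne_zero hC
    obtain ⟨ω', -, hω'⟩ := exists_ne_zero_of_sum_ne_zero hC'
    simp only [ne_eq, mul_ite, mul_one, mul_zero, ite_eq_right_iff, not_forall] at hω hω'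
    obtain ⟨h1, h2⟩ := hω
    obtain ⟨h3, h4⟩ := hω'
    obtain ⟨p, q, h⟩ := hsupp ω h2 a C h1
    obtain ⟨p', q', h'⟩ := hsupp ω' h4 a' C' h3
    exact h.crossFree (fun u v => hy _) h'
  · intro u v huv
    refine le_trans (le_of_eq ?_) (hload (u, v) huv)
    simp only [W, mul_sum]
    rw [sum_comm (s := univ (α := Ω))]
    refine sum_congr rfl fun a _ => ?_
    have h1 : ∀ C : Finset V, (if Separates C u v then
        ∑ ω : Ω, x ω * (if C ∈ (ω a).1 then (1 : ℝ) else 0) else 0) =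
        ∑ ω : Ω, if C ∈ (ω a).1 then x ω * (if Separates C u v then 1 else 0) else 0 := by
      intro C
      split_ifs <;> simp
    simp only [h1]
    rw [sum_comm]
    exact sum_congr rfl fun ω _ => by rw [← sum_filter, filter_mem_eq_inter, univ_inter]

/-- Orienting all cuts away from a fixed vertex makes a cross-free family laminar. -/
lemma exists_laminar_weights {ι : Type} {w : ι → Finset V → ℝ} (hw : ∀ a C, 0 ≤ w a C)
    (hcross : ∀ a a' C C', w a C ≠ 0 → w a' C' ≠ 0 → CrossFree C C') :
    ∃ w' : ι → Finset V → ℝ, (∀ a C, 0 ≤ w' a C) ∧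
      (∀ a a' C C', w' a C ≠ 0 → w' a' C' ≠ 0 → C ⊆ C' ∨ C' ⊆ C ∨ Disjoint C C') ∧
      ∀ a u v, ∑ C, (if Separates C u v then w' a C else 0) =
        ∑ C, if Separates C u v then w a C else 0 := by
  rcases isEmpty_or_nonempty V with hV | ⟨⟨v₀⟩⟩
  · exact ⟨w, hw, fun a a' C C' _ _ => Or.inl fun u => isEmptyElim u, fun a u => isEmptyElim u⟩
  refine ⟨fun a C => if v₀ ∈ C then 0 else w a C + w a Cᶜ, ?_, ?_, ?_⟩
  · intro a C
    dsimp only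
    split_ifs
    exacts [le_rfl, add_nonneg (hw _ _) (hw _ _)]
  · intro a a' C C' hC hC'
    simp only [ne_eq, ite_eq_left_iff, not_forall] at hC hC'
    obtain ⟨h1, h2⟩ := hC
    obtain ⟨h3, h4⟩ := hC'
    have hcf : CrossFree C C' := by
      have e1 : w a C ≠ 0 ∨ w a Cᶜ ≠ 0 := by
        by_contra! h
        exact h2 (by rw [h.1, h.2, add_zero])
      have e2 : w a' C' ≠ 0 ∨ w a' C'ᶜ ≠ 0 := by
        by_contra! h
        exact h4 (by rw [h.1, h.2, add_zero])
      rcases e1 with e1 | e1 <;> rcases e2 with e2 | e2 <;>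
        have h := hcross _ _ _ _ e1 e2 <;>
        simp only [CrossFree, mem_compl, not_not] at h ⊢ <;> tauto
    rcases hcf with h | h | h | h
    · exact Or.inr (Or.inr (disjoint_left.2 fun u hu hu' => h u ⟨hu, hu'⟩))
    · exact Or.inl fun u hu => by_contra fun hu' => h u ⟨hu, hu'⟩
    · exact Or.inr (Or.inl fun u hu => by_contra fun hu' => h u ⟨hu', hu⟩)
    · exact absurd ⟨h1, h3⟩ (h v₀)
  · intro a u v
    have hsc : ∀ C : Finset V, Separates Cᶜ u v ↔ Separates C u v := fun C => by
      simp only [Separates, mem_compl]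
      tauto
    have hflip : ∑ C : Finset V, (if v₀ ∈ C then 0 else if Separates C u v then w a Cᶜ else 0) =
        ∑ C : Finset V, if v₀ ∈ C then if Separates C u v then w a C else 0 else 0 := by
      rw [← Equiv.sum_comp (Function.Involutive.toPerm compl compl_involutive)]
      refine sum_congr rfl fun C _ => ?_
      simp only [Function.Involutive.coe_toPerm, hsc, mem_compl, compl_compl, ite_not]
    calc _ = ∑ C : Finset V, ((if v₀ ∈ C then 0 else if Separates C u v then w a C else 0) +
          if v₀ ∈ C then 0 else if Separates C u v then w a Cᶜ else 0) := by
          refine sum_congr rfl fun C _ => ?_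
          by_cases h1 : Separates C u v <;> by_cases h2 : v₀ ∈ C <;> simp [h1, h2]
      _ = _ := by
          rw [sum_add_distrib, hflip, ← sum_add_distrib]
          refine sum_congr rfl fun C _ => ?_
          split_ifs <;> simp

end Weights

section Laminar

variable {V : Type} [Fintype V] [DecidableEq V]

/-- The support of `v` is a laminar family. -/
def IsLaminarWeight (v : Finset V → ℝ) : Prop :=
  ∀ C D, v C ≠ 0 → v D ≠ 0 → C ⊆ D ∨ D ⊆ C ∨ Disjoint C D

/-- The total weight of the supersets of `C`. -/
def weightAbove (v : Finset V → ℝ) (C : Finset V) : ℝ := ∑ D with C ⊆ D, v D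

/-- The total weight of the strict supersets of `C`. -/
def weightStrictAbove (v : Finset V → ℝ) (C : Finset V) : ℝ := ∑ D with C ⊂ D, v D

/-- The integral levels of the interval of length `v C` occupied by `C`. -/
noncomputable def levels (v : Finset V → ℝ) (C : Finset V) : Finset ℕ :=
  Ico ⌊weightStrictAbove v C⌋₊ ⌊weightAbove v C⌋₊

lemma IsLaminarWeight.comparable {V : Type} {v : Finset V → ℝ} (hv : IsLaminarWeight v) {C D : Finset V}
    (hC : v C ≠ 0) (hD : v D ≠ 0) {u : V} (huC : u ∈ C) (huD : u ∈ D) : C ⊆ D ∨ D ⊆ C := by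
  rcases hv C D hC hD with h | h | h
  exacts [Or.inl h, Or.inr h, absurd huD (disjoint_left.1 h huC)]

lemma weightAbove_eq (v : Finset V → ℝ) (C : Finset V) :
    weightAbove v C = weightStrictAbove v C + v C := by
  have : (univ.filter fun D => C ⊆ D) = insert C (univ.filter fun D => C ⊂ D) := by
    ext D
    simp only [mem_filter_univ, mem_insert, subset_iff_ssubset_or_eq]
    tauto
  rw [weightAbove, weightStrictAbove, this, sum_insert (by simp), add_comm]

lemma weightStrictAbove_nonneg {v : Finset V → ℝ} (hv : ∀ C, 0 ≤ v C) (C : Finset V) :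
    0 ≤ weightStrictAbove v C := sum_nonneg fun D _ => hv D

lemma weightStrictAbove_le_weightAbove {v : Finset V → ℝ} (hv : ∀ C, 0 ≤ v C) (C : Finset V) :
    weightStrictAbove v C ≤ weightAbove v C := by
  linarith [weightAbove_eq v C, hv C]

lemma weightAbove_le_weightStrictAbove {v : Finset V → ℝ} (hv : ∀ C, 0 ≤ v C) {C D : Finset V}
    (h : C ⊂ D) : weightAbove v D ≤ weightStrictAbove v C :=
  sum_le_sum_of_subset_of_nonneg
    (fun _ hE => mem_filter.2 ⟨mem_univ _, h.trans_subset (mem_filter.1 hE).2⟩) fun _ _ _ => hv _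

lemma mem_levels {v : Finset V → ℝ} (hv : ∀ C, 0 ≤ v C) {C : Finset V} {m : ℕ} :
    m ∈ levels v C ↔ weightStrictAbove v C < m + 1 ∧ (m : ℝ) + 1 ≤ weightAbove v C := by
  have h1 := weightStrictAbove_nonneg hv C
  rw [levels, mem_Ico, ← Nat.lt_succ_iff, Nat.floor_lt h1, ← Nat.succ_le_iff,
    Nat.le_floor_iff (h1.trans (weightStrictAbove_le_weightAbove hv C))]
  push_cast
  rfl

lemma ne_zero_of_mem_levels {v : Finset V → ℝ} (hv : ∀ C, 0 ≤ v C) {C : Finset V} {m : ℕ}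
    (h : m ∈ levels v C) : v C ≠ 0 := by
  rw [mem_levels hv] at h
  intro h0
  linarith [weightAbove_eq v C, h.1, h.2]

lemma sum_telescope_chain {V : Type} [DecidableEq V] (v : Finset V → ℝ) (φ : ℝ → ℝ) (K : Finset (Finset V))
    (hK : ∀ C ∈ K, ∀ D ∈ K, C ⊆ D ∨ D ⊆ C) :
    ∑ D ∈ K, (φ (∑ E ∈ K with D ⊆ E, v E) - φ (∑ E ∈ K with D ⊂ E, v E)) =
      φ (∑ E ∈ K, v E) - φ 0 := by
  induction K using Finset.induction_on_min_value (fun C : Finset V => C.card) with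
  | empty => simp
  | insert C K hC hmin ih =>
    have hlt : ∀ D ∈ K, C ⊂ D := by
      intro D hD
      have hne : C ≠ D := fun h => hC (h ▸ hD)
      rcases hK C (mem_insert_self _ _) D (mem_insert_of_mem hD) with h | h
      · exact Finset.ssubset_iff_subset_ne.2 ⟨h, hne⟩
      · exact absurd (eq_of_subset_of_card_le h (hmin D hD)).symm hne
    have e1 : ((insert C K).filter fun E => C ⊆ E) = insert C K :=
      filter_true_of_mem fun E hE => by
        rcases mem_insert.1 hE with rfl | hE
        exacts [subset_rfl, (hlt E hE).subset]
    have e2 : ((insert C K).filter fun E => C ⊂ E) = K := by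
      rw [filter_insert, if_neg (ssubset_irrefl C)]
      exact filter_true_of_mem hlt
    have e3 : ∀ D ∈ K, ((insert C K).filter fun E => D ⊆ E) = K.filter fun E => D ⊆ E :=
      fun D hD => by rw [filter_insert, if_neg (hlt D hD).not_subset]
    have e4 : ∀ D ∈ K, ((insert C K).filter fun E => D ⊂ E) = K.filter fun E => D ⊂ E :=
      fun D hD => by rw [filter_insert, if_neg fun h => (hlt D hD).not_subset h.subset]
    have e5 : ∑ D ∈ K, (φ (∑ E ∈ insert C K with D ⊆ E, v E) -
        φ (∑ E ∈ insert C K with D ⊂ E, v E)) =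
        ∑ D ∈ K, (φ (∑ E ∈ K with D ⊆ E, v E) - φ (∑ E ∈ K with D ⊂ E, v E)) :=
      sum_congr rfl fun D hD => by rw [e3 D hD, e4 D hD]
    rw [sum_insert hC, e1, e2, e5, ih fun C hC D hD => hK C (mem_insert_of_mem hC) D (mem_insert_of_mem hD)]
    ring

/-- Telescoping along the sets of a laminar family which satisfy an upward closed condition that
forces them to be comparable. -/
lemma sum_telescope {v : Finset V → ℝ} (U : Finset V → Prop) [DecidablePred U]
    (hup : ∀ C D, C ⊆ D → U C → U D)
    (hchain : ∀ C D, U C → U D → v C ≠ 0 → v D ≠ 0 → C ⊆ D ∨ D ⊆ C) (φ : ℝ → ℝ) :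
    ∑ D with U D, (φ (weightAbove v D) - φ (weightStrictAbove v D)) =
      φ (∑ D with U D, v D) - φ 0 := by
  classical
  set K : Finset (Finset V) := univ.filter fun D => U D ∧ v D ≠ 0 with hK
  have h1 : ∑ D with U D, v D = ∑ D ∈ K, v D := by
    rw [hK, ← filter_filter]
    exact (sum_filter_ne_zero _).symm
  have h2 : ∀ D, U D → weightAbove v D = ∑ E ∈ K with D ⊆ E, v E := by
    intro D hD
    rw [hK, weightAbove, filter_filter, ← sum_filter_ne_zero, filter_filter]
    refine sum_congr (filter_congr fun E _ => ?_) fun _ _ => rfl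
    exact ⟨fun h => ⟨⟨hup _ _ h.1 hD, h.2⟩, h.1⟩, fun h => ⟨h.2, h.1.2⟩⟩
  have h3 : ∀ D, U D → weightStrictAbove v D = ∑ E ∈ K with D ⊂ E, v E := by
    intro D hD
    rw [hK, weightStrictAbove, filter_filter, ← sum_filter_ne_zero, filter_filter]
    refine sum_congr (filter_congr fun E _ => ?_) fun _ _ => rfl
    exact ⟨fun h => ⟨⟨hup _ _ h.1.subset hD, h.2⟩, h.1⟩, fun h => ⟨h.2, h.1.2⟩⟩
  rw [h1, ← sum_telescope_chain v φ K fun C hC D hD => hchain C D (mem_filter.1 hC).2.1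
    (mem_filter.1 hD).2.1 (mem_filter.1 hC).2.2 (mem_filter.1 hD).2.2]
  refine (sum_subset_zero_on_sdiff (fun D hD => ?_) (fun D hD => ?_) fun D hD => ?_).symm
  · exact mem_filter.2 ⟨mem_univ _, (mem_filter.1 hD).2.1⟩
  · have hU : U D := (mem_filter.1 (mem_sdiff.1 hD).1).2
    have h0 : v D = 0 := by
      by_contra h
      exact (mem_sdiff.1 hD).2 (mem_filter.2 ⟨mem_univ _, hU, h⟩)
    rw [weightAbove_eq, h0, add_zero, sub_self]
  · rw [h2 D (mem_filter.1 hD).2.1, h3 D (mem_filter.1 hD).2.1]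

end Laminar

/-- The part of `[0, x]` inside `[m, m + 1]`. -/
noncomputable def ramp (m : ℕ) (x : ℝ) : ℝ := max 0 (min 1 (x - m))

lemma ramp_mono (m : ℕ) : Monotone (ramp m) := fun x y h => by
  unfold ramp
  gcongr

lemma ramp_nonneg (m : ℕ) (x : ℝ) : 0 ≤ ramp m x := le_max_left _ _

lemma ramp_le_one (m : ℕ) (x : ℝ) : ramp m x ≤ 1 := max_le zero_le_one (min_le_left _ _)

lemma ramp_eq_one {m : ℕ} {x : ℝ} (h : (m : ℝ) + 1 ≤ x) : ramp m x = 1 := by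
  rw [ramp, min_eq_left (by linarith), max_eq_right zero_le_one]

lemma sum_ramp {x : ℝ} (hx : 0 ≤ x) (K : ℕ) : ∑ m ∈ range K, ramp m x = min x K := by
  induction K with
  | zero => simp [hx]
  | succ K ih =>
    rw [sum_range_succ, ih, ramp]
    push_cast
    grind

/-- A fractional assignment in which every token is assigned at least as much as any slot receives
can be made integral. -/
lemma exists_injective_of_fractional {τ σ : Type} [Fintype τ] [DecidableEq σ] {N : τ → Finset σ}
    {F : τ → σ → ℝ} (hF : ∀ t s, 0 ≤ F t s) {ε : ℝ} (hε : 0 < ε)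
    (hout : ∀ t, ε ≤ ∑ s ∈ N t, F t s) (hin : ∀ s, ∑ t with s ∈ N t, F t s ≤ ε) :
    ∃ f : τ → σ, Function.Injective f ∧ ∀ t, f t ∈ N t := by
  refine (all_card_le_biUnion_card_iff_exists_injective N).1 fun A => ?_
  have h : (A.card : ℝ) * ε ≤ (A.biUnion N).card * ε := by
    calc (A.card : ℝ) * ε = ∑ t ∈ A, ε := by simp
      _ ≤ ∑ t ∈ A, ∑ s ∈ N t, F t s := sum_le_sum fun t _ => hout t
      _ = ∑ s ∈ A.biUnion N, ∑ t ∈ A with s ∈ N t, F t s :=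
          sum_comm' fun t s => by
            simp only [mem_filter, mem_biUnion]
            exact ⟨fun h => ⟨⟨h.1, h.2⟩, t, h.1, h.2⟩, fun h => h.1⟩
      _ ≤ ∑ s ∈ A.biUnion N, ε := by
          refine sum_le_sum fun s _ => le_trans ?_ (hin s)
          exact sum_le_sum_of_subset_of_nonneg (filter_subset_filter _ (subset_univ A))
            fun t _ _ => hF t s
      _ = (A.biUnion N).card * ε := by simp
  exact_mod_cast le_of_mul_le_mul_right h hε

/-- Tokens `t` located at `pt t`, which spread weight `1 / 2` over the sets of a laminar family, can
be assigned distinct integral levels of sets containing them. -/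
lemma exists_injective_levels {V τ : Type} [Fintype V] [DecidableEq V] [Fintype τ]
    {v : Finset V → ℝ} (hv0 : ∀ C, 0 ≤ v C) (hv : IsLaminarWeight v) (pt : τ → V)
    (ok : τ → Finset V → Prop) [∀ t, DecidablePred (ok t)] (hok : ∀ t C D, C ⊆ D → ok t D → ok t C)
    {g : τ → Finset V → ℝ} (hg0 : ∀ t D, 0 ≤ g t D) (hgs : ∀ t D, g t D ≠ 0 → pt t ∈ D ∧ ok t D)
    (hg1 : ∀ t, 1 / 2 ≤ ∑ D, g t D) (hg2 : ∀ D, ∑ t, g t D ≤ v D / 4) :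
    ∃ f : τ → (_ : Finset V) × ℕ, Function.Injective f ∧
      ∀ t, pt t ∈ (f t).1 ∧ ok t (f t).1 ∧ (f t).2 ∈ levels v (f t).1 := by
  have hgv : ∀ t D, g t D ≤ v D / 4 := fun t D =>
    (single_le_sum (f := fun t => g t D) (fun t _ => hg0 t D) (mem_univ t)).trans (hg2 D)
  have hgne : ∀ t D, g t D ≠ 0 → v D ≠ 0 := by
    intro t D h h0
    have := hgv t D
    rw [h0, zero_div] at this
    exact h (le_antisymm this (hg0 t D))
  have hchain : ∀ u C D, u ∈ C → u ∈ D → v C ≠ 0 → v D ≠ 0 → C ⊆ D ∨ D ⊆ C :=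
    fun u C D h1 h2 h3 h4 => hv.comparable h3 h4 h1 h2
  have hPQ := weightStrictAbove_le_weightAbove hv0
  have hQ0 := weightStrictAbove_nonneg hv0
  let F : τ → ℕ → ℝ := fun t m => ∑ D, g t D / v D *
    (ramp m (weightAbove v D) - ramp m (weightStrictAbove v D))
  have hF0 : ∀ t m, 0 ≤ F t m := fun t m => sum_nonneg fun D _ =>
    mul_nonneg (div_nonneg (hg0 t D) (hv0 D)) (sub_nonneg.2 (ramp_mono m (hPQ D)))
  let N : τ → Finset ((_ : Finset V) × ℕ) := fun t =>
    (univ.filter fun C => pt t ∈ C ∧ ok t C).sigma (levels v)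
  have hN : ∀ t s, s ∈ N t ↔ (pt t ∈ s.1 ∧ ok t s.1) ∧ s.2 ∈ levels v s.1 := fun t s => by
    simp [N]
  let β : τ → ℝ := fun t => ∑ D with pt t ∈ D, v D
  have hβ0 : ∀ t, 0 ≤ β t := fun t => sum_nonneg fun D _ => hv0 D
  have htel : ∀ t (φ : ℝ → ℝ), ∑ D with pt t ∈ D,
      (φ (weightAbove v D) - φ (weightStrictAbove v D)) = φ (β t) - φ 0 := fun t φ =>
    sum_telescope (fun D => pt t ∈ D) (fun C D h h' => h h') (hchain (pt t)) φ
  have hfull : ∀ t, 1 / 4 ≤ ∑ m ∈ range ⌊β t⌋₊, F t m := by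
    intro t
    set K := ⌊β t⌋₊ with hK
    let ψ : ℝ → ℝ := fun x => x - min x K
    have hψ : Monotone ψ := fun x z h => by
      simp only [ψ]
      grind
    have e1 : ∑ m ∈ range K, F t m = ∑ D, g t D / v D *
        (min (weightAbove v D) K - min (weightStrictAbove v D) K) := by
      simp only [F]
      rw [sum_comm]
      refine sum_congr rfl fun D _ => ?_
      rw [← mul_sum, sum_sub_distrib, sum_ramp ((hQ0 D).trans (hPQ D)), sum_ramp (hQ0 D)]
    have e2 : ∀ D, g t D = g t D / v D * (weightAbove v D - weightStrictAbove v D) := by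
      intro D
      rw [weightAbove_eq, add_sub_cancel_left]
      by_cases h : g t D = 0
      · simp [h]
      · rw [div_mul_cancel₀ _ (hgne t D h)]
    have e3 : ∑ D, g t D - ∑ m ∈ range K, F t m = ∑ D, g t D / v D *
        (ψ (weightAbove v D) - ψ (weightStrictAbove v D)) := by
      rw [e1, sum_congr rfl fun D _ => e2 D, ← sum_sub_distrib]
      exact sum_congr rfl fun D _ => by simp only [ψ]; ring
    have e4 : ∑ D, g t D / v D * (ψ (weightAbove v D) - ψ (weightStrictAbove v D)) ≤
        ∑ D with pt t ∈ D, 1 / 4 * (ψ (weightAbove v D) - ψ (weightStrictAbove v D)) := by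
      rw [sum_filter]
      refine sum_le_sum fun D _ => ?_
      have hnn : 0 ≤ ψ (weightAbove v D) - ψ (weightStrictAbove v D) := sub_nonneg.2 (hψ (hPQ D))
      by_cases h : g t D = 0
      · rw [h, zero_div, zero_mul]
        split_ifs
        exacts [mul_nonneg (by norm_num) hnn, le_rfl]
      · rw [if_pos (hgs t D h).1]
        refine mul_le_mul_of_nonneg_right ?_ hnn
        rw [div_le_iff₀ (lt_of_le_of_ne (hv0 D) (hgne t D h).symm)]
        linarith [hgv t D]
    rw [← mul_sum, htel] at e4
    have e5 : ψ (β t) ≤ 1 := by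
      simp only [ψ]
      rw [min_eq_right (Nat.floor_le (hβ0 t))]
      linarith [Nat.lt_floor_add_one (β t)]
    have e6 : ψ 0 = 0 := by simp [ψ]
    linarith [hg1 t]
  have hslot : ∀ t, ∀ m < ⌊β t⌋₊, F t m ≠ 0 → ∃ s ∈ N t, s.2 = m := by
    intro t m hm hF
    obtain ⟨D, -, hD⟩ := exists_ne_zero_of_sum_ne_zero hF
    have hgD : g t D ≠ 0 := fun h => hD (by rw [h, zero_div, zero_mul])
    have hQD : weightStrictAbove v D < m + 1 := by
      by_contra! h
      exact hD (by rw [ramp_eq_one h, ramp_eq_one (h.trans (hPQ D)), sub_self, mul_zero])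
    have hmβ : (m : ℝ) + 1 ≤ β t := by
      have := (Nat.le_floor_iff (hβ0 t)).1 (Nat.succ_le_of_lt hm)
      exact_mod_cast this
    have h1 := htel t fun x => if (m : ℝ) + 1 ≤ x then 1 else 0
    simp only [if_pos hmβ] at h1
    rw [if_neg (not_le.2 (by positivity) : ¬(m : ℝ) + 1 ≤ 0), sub_zero] at h1
    obtain ⟨C, hC, hne⟩ := exists_ne_zero_of_sum_ne_zero (h1.trans_ne one_ne_zero)
    have hC := (mem_filter.1 hC).2
    have hlev : m ∈ levels v C := by
      rw [mem_levels hv0]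
      have := hPQ C
      split_ifs at hne with h2 h3 h3
      · simp at hne
      · exact ⟨not_le.1 h3, h2⟩
      · linarith
      · simp at hne
    have hCD : C ⊆ D := by
      rcases hchain _ C D hC (hgs t D hgD).1 (ne_zero_of_mem_levels hv0 hlev) (hgne t D hgD) with
        h | h
      · exact h
      · by_contra hn
        have := weightAbove_le_weightStrictAbove hv0 (ssubset_of_subset_not_subset h hn)
        linarith [((mem_levels hv0).1 hlev).2]
    exact ⟨⟨C, m⟩, (hN t _).2 ⟨⟨hC, hok t C D hCD (hgs t D hgD).2⟩, hlev⟩, rfl⟩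
  have hout : ∀ t, 1 / 4 ≤ ∑ s ∈ N t, F t s.2 := by
    intro t
    refine (hfull t).trans ?_
    rw [← sum_filter_ne_zero]
    calc ∑ m ∈ range ⌊β t⌋₊ with F t m ≠ 0, F t m ≤ ∑ m ∈ (N t).image (·.2), F t m := by
          refine sum_le_sum_of_subset_of_nonneg (fun m hm => ?_) fun m _ _ => hF0 t m
          obtain ⟨hm, hne⟩ := mem_filter.1 hm
          exact mem_image.2 (hslot t m (mem_range.1 hm) hne)
      _ ≤ _ := sum_image_le_of_nonneg fun m _ => hF0 t m
  have hin : ∀ s, ∑ t with s ∈ N t, F t s.2 ≤ 1 / 4 := by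
    rintro ⟨C, m⟩
    by_cases hex : ∃ t, (⟨C, m⟩ : (_ : Finset V) × ℕ) ∈ N t
    swap
    · push Not at hex
      rw [filter_false_of_mem fun t _ => hex t, sum_empty]
      norm_num
    obtain ⟨t₀, ht₀⟩ := hex
    obtain ⟨⟨ht₀, -⟩, hlev⟩ := (hN _ _).1 ht₀
    have hvC := ne_zero_of_mem_levels hv0 hlev
    have hlev := (mem_levels hv0).1 hlev
    have hterm : ∀ D, ∑ t with (⟨C, m⟩ : (_ : Finset V) × ℕ) ∈ N t, g t D / v D *
        (ramp m (weightAbove v D) - ramp m (weightStrictAbove v D)) ≤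
        if C ⊆ D then 1 / 4 * (ramp m (weightAbove v D) - ramp m (weightStrictAbove v D))
        else 0 := by
      intro D
      have hnn := sub_nonneg.2 (ramp_mono m (hPQ D))
      split_ifs with hCD
      · rw [← sum_mul, ← sum_div]
        refine mul_le_mul_of_nonneg_right ?_ hnn
        have h1 : ∑ t with (⟨C, m⟩ : (_ : Finset V) × ℕ) ∈ N t, g t D ≤ v D / 4 :=
          (sum_le_sum_of_subset_of_nonneg (filter_subset _ _) fun t _ _ => hg0 t D).trans (hg2 D)
        rcases (hv0 D).eq_or_lt with h | h
        · rw [← h, div_zero]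
          norm_num
        · rw [div_le_iff₀ h]
          linarith
      · refine (sum_eq_zero fun t ht => ?_).le
        by_cases hgD : g t D = 0
        · rw [hgD, zero_div, zero_mul]
        have htC := ((hN _ _).1 (mem_filter.1 ht).2).1.1
        have hDC := (hchain _ C D htC (hgs t D hgD).1 hvC (hgne t D hgD)).resolve_left hCD
        have := weightAbove_le_weightStrictAbove hv0 (ssubset_of_subset_not_subset hDC hCD)
        rw [ramp_eq_one (hlev.2.trans this), ramp_eq_one (hlev.2.trans (this.trans (hPQ D))),
          sub_self, mul_zero]
    simp only [F]
    rw [sum_comm]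
    refine (sum_le_sum fun D _ => hterm D).trans ?_
    rw [← sum_filter, ← mul_sum, sum_telescope (fun D => C ⊆ D) (fun D E h h' => h'.trans h)
      (fun D E h1 h2 => hchain _ D E (h1 ht₀) (h2 ht₀)) (ramp m)]
    linarith [ramp_le_one m (∑ D with C ⊆ D, v D), ramp_nonneg m 0]
  have key := exists_injective_of_fractional (N := N) (F := fun t s => F t s.2) (ε := 1 / 4)
    (fun t s => hF0 t _) (by norm_num) hout hin
  obtain ⟨f, hf, hfN⟩ := key
  exact ⟨f, hf, fun t => by
    obtain ⟨⟨h1, h2⟩, h3⟩ := (hN _ _).1 (hfN t)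
    exact ⟨h1, h2, h3⟩⟩

/-- Distinct levels of sets containing `u` but not `v` are distinct integers, and there are at most
one more of them than the total weight of such sets. -/
lemma card_levels_le {V τ : Type} [Fintype V] [DecidableEq V] {w : Finset V → ℝ}
    (hw0 : ∀ C, 0 ≤ w C) (hw : IsLaminarWeight w) (A : Finset τ) {f : τ → (_ : Finset V) × ℕ}
    (hf : Function.Injective f) (u v : V)
    (hA : ∀ t ∈ A, u ∈ (f t).1 ∧ v ∉ (f t).1 ∧ (f t).2 ∈ levels w (f t).1) :
    (A.card : ℝ) ≤ ∑ C with u ∈ C ∧ v ∉ C, w C + 1 := by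
  have hne : ∀ t ∈ A, w (f t).1 ≠ 0 := fun t ht => ne_zero_of_mem_levels hw0 (hA t ht).2.2
  set α := ∑ C with u ∈ C ∧ v ∈ C, w C with hα
  set β := ∑ C with u ∈ C, w C with hβ
  have hαβ : β = α + ∑ C with u ∈ C ∧ v ∉ C, w C := by
    rw [hα, hβ, ← filter_filter, ← filter_filter, sum_filter_add_sum_filter_not]
  have hα0 : 0 ≤ α := sum_nonneg fun C _ => hw0 C
  have hdiff : 0 ≤ ∑ C with u ∈ C ∧ v ∉ C, w C := sum_nonneg fun C _ => hw0 C
  have hαQ : ∀ t ∈ A, α ≤ weightStrictAbove w (f t).1 := by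
    intro t ht
    rw [hα, ← sum_filter_ne_zero]
    refine sum_le_sum_of_subset_of_nonneg (fun D hD => ?_) fun D _ _ => hw0 D
    simp only [mem_filter, mem_univ, true_and] at hD ⊢
    have hn : ¬D ⊆ (f t).1 := fun h => (hA t ht).2.1 (h hD.1.2)
    exact ssubset_of_subset_not_subset
      ((hw.comparable (hne t ht) hD.2 (hA t ht).1 hD.1.1).resolve_right hn) hn
  have hPβ : ∀ t ∈ A, weightAbove w (f t).1 ≤ β := fun t ht =>
    sum_le_sum_of_subset_of_nonneg (fun D hD => by
      simp only [mem_filter, mem_univ, true_and] at hD ⊢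
      exact hD (hA t ht).1) fun D _ _ => hw0 D
  have hcard : A.card ≤ (Ico ⌊α⌋₊ ⌊β⌋₊).card := by
    refine card_le_card_of_injOn (fun t => (f t).2) (fun t ht => ?_) fun t ht t' ht' heq => ?_
    · have h := mem_Ico.1 (hA t ht).2.2
      exact mem_coe.2 (mem_Ico.2 ⟨(Nat.floor_mono (hαQ t ht)).trans h.1,
        h.2.trans_le (Nat.floor_mono (hPβ t ht))⟩)
    · have hlt : ∀ s ∈ A, ∀ s' ∈ A, (f s).2 = (f s').2 → (f s).1 ⊆ (f s').1 →
          (f s').1 ⊆ (f s).1 := by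
        intro s hs s' hs' heq h
        by_contra hn
        have h1 := weightAbove_le_weightStrictAbove hw0 (ssubset_of_subset_not_subset h hn)
        have h2 := (mem_levels hw0).1 (hA s hs).2.2
        have h3 := (mem_levels hw0).1 (hA s' hs').2.2
        rw [heq] at h2
        linarith [h2.1, h3.2]
      have hset : (f t).1 = (f t').1 := by
        rcases hw.comparable (hne t ht) (hne t' ht') (hA t ht).1 (hA t' ht').1 with h | h
        · exact h.antisymm (hlt t ht t' ht' heq h)
        · exact (hlt t' ht' t ht heq.symm h).antisymm h
      exact hf (Sigma.ext hset (heq_of_eq heq))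
  rw [Nat.card_Ico] at hcard
  have h1 : (A.card : ℝ) ≤ (⌊β⌋₊ : ℝ) - ⌊α⌋₊ := by
    rw [← Nat.cast_sub (Nat.floor_mono (by linarith))]
    exact_mod_cast hcard
  linarith [Nat.floor_le (hα0.trans (by linarith : α ≤ β)), Nat.lt_floor_add_one α]

/-- Rounding laminar fractional cuts to one set around each element of each `R a`. -/
lemma exists_rounding {V ι : Type} [Fintype V] [DecidableEq V] [Fintype ι] (R : ι → Finset V)
    {w : ι → Finset V → ℝ} (hw0 : ∀ a C, 0 ≤ w a C)
    (hlam : ∀ a a' C C', w a C ≠ 0 → w a' C' ≠ 0 → C ⊆ C' ∨ C' ⊆ C ∨ Disjoint C C')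
    (hsep : ∀ a, ∀ p ∈ R a, ∀ q ∈ R a, p ≠ q → 1 ≤ ∑ C, if Separates C p q then w a C else 0) :
    ∃ f : ι → V → Finset V, (∀ a, ∀ p ∈ R a, p ∈ f a p) ∧
      (∀ a, ∀ p ∈ R a, ∀ q ∈ R a, p ≠ q → q ∉ f a p ∨ p ∉ f a q) ∧
      ∀ u v, ((univ.filter fun t : ι × V =>
        t.2 ∈ R t.1 ∧ u ∈ f t.1 t.2 ∧ v ∉ f t.1 t.2).card : ℝ) ≤
        4 * ∑ a, ∑ C with u ∈ C ∧ v ∉ C, w a C + 1 := by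
  classical
  set v : Finset V → ℝ := fun C => 4 * ∑ a, w a C with hv
  have hv0 : ∀ C, 0 ≤ v C := fun C => mul_nonneg (by norm_num) (sum_nonneg fun a _ => hw0 a C)
  have hvlam : IsLaminarWeight v := by
    intro C D hC hD
    obtain ⟨a, -, ha⟩ := exists_ne_zero_of_sum_ne_zero (right_ne_zero_of_mul hC)
    obtain ⟨a', -, ha'⟩ := exists_ne_zero_of_sum_ne_zero (right_ne_zero_of_mul hD)
    exact hlam a a' C D ha ha'
  have hwv : ∀ a C, w a C ≠ 0 → v C ≠ 0 := by
    intro a C h h0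
    have h1 := single_le_sum (f := fun a => w a C) (fun a _ => hw0 a C) (mem_univ a)
    simp only [hv] at h0
    exact h (le_antisymm (by linarith) (hw0 a C))
  let inner : ι × V → Finset V → ℝ := fun t C => ∑ D with D ⊂ C ∧ t.2 ∈ D, w t.1 D
  have hinner : ∀ t C D, C ⊆ D → inner t C ≤ inner t D := fun t C D h =>
    sum_le_sum_of_subset_of_nonneg (fun E hE => by
      simp only [mem_filter, mem_univ, true_and] at hE ⊢
      exact ⟨hE.1.trans_subset h, hE.2⟩) fun E _ _ => hw0 _ E
  let g : ι × V → Finset V → ℝ := fun t D => if t.2 ∈ D ∧ inner t D < 1 / 2 then w t.1 D else 0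
  have hg0 : ∀ t D, 0 ≤ g t D := fun t D => by
    simp only [g]
    split_ifs
    exacts [hw0 _ _, le_rfl]
  let heavy : ι × V → Prop := fun t => t.2 ∈ R t.1 ∧ 1 / 2 ≤ ∑ D with t.2 ∈ D, w t.1 D
  have hspread : ∀ t, heavy t → 1 / 2 ≤ ∑ D, g t D := by
    intro t ht
    rcases (univ.filter fun D => t.2 ∈ D ∧ ¬inner t D < 1 / 2).eq_empty_or_nonempty with he | hne
    · refine ht.2.trans ?_
      rw [sum_filter]
      refine sum_le_sum fun D _ => ?_
      split_ifs with hD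
      · have : inner t D < 1 / 2 := by
          by_contra h
          exact (filter_eq_empty_iff.1 he (mem_univ D)) ⟨hD, h⟩
        simp only [g]
        rw [if_pos ⟨hD, this⟩]
      · exact hg0 t D
    · obtain ⟨D₀, hD₀, hmin⟩ := exists_min_image _ (fun D : Finset V => D.card) hne
      refine (not_lt.1 (mem_filter.1 hD₀).2.2).trans ?_
      simp only [inner]
      rw [sum_filter]
      refine sum_le_sum fun D _ => ?_
      split_ifs with hD
      · have : inner t D < 1 / 2 := by
          by_contra h
          exact (card_lt_card hD.1).not_ge (hmin D (mem_filter.2 ⟨mem_univ _, hD.2, h⟩))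
        simp only [g]
        rw [if_pos ⟨hD.2, this⟩]
      · exact hg0 t D
  have huniq : ∀ a D p q, p ∈ R a → q ∈ R a → g (a, p) D ≠ 0 → g (a, q) D ≠ 0 → p = q := by
    intro a D p q hp hq hgp hgq
    by_contra hne
    simp only [g, ne_eq, ite_eq_right_iff, not_forall] at hgp hgq
    obtain ⟨⟨hpD, hpi⟩, hwD⟩ := hgp
    obtain ⟨⟨hqD, hqi⟩, -⟩ := hgq
    have hle : ∑ C, (if Separates C p q then w a C else 0) ≤ inner (a, p) D + inner (a, q) D := by
      simp only [inner]
      rw [sum_filter, sum_filter, ← sum_add_distrib]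
      refine sum_le_sum fun C _ => ?_
      have hc := hw0 a C
      by_cases hC : w a C = 0
      · simp [hC]
      have hsub : ∀ p q, p ∈ D → q ∈ D → p ∈ C → q ∉ C → C ⊂ D := by
        intro p q hpD hqD hpC hqC
        have hn : ¬D ⊆ C := fun h => hqC (h hqD)
        exact ssubset_of_subset_not_subset
          ((hvlam.comparable (hwv a C hC) (hwv a D hwD) hpC hpD).resolve_right hn) hn
      by_cases h1 : p ∈ C <;> by_cases h2 : q ∈ C
      · simp only [Separates, h1, h2, not_true_eq_false, if_false]
        split_ifs <;> linarith
      · simp [Separates, h1, h2, hsub p q hpD hqD h1 h2]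
      · simp [Separates, h1, h2, hsub q p hqD hpD h2 h1]
      · simp [Separates, h1, h2]
    linarith [hsep a p hp q hq hne]
  have hload : ∀ D, ∑ t : {t // heavy t}, g t D ≤ v D / 4 := by
    intro D
    have h1 : ∑ t : {t // heavy t}, g t D = ∑ t with heavy t, g t D :=
      (sum_subtype _ (fun t => by simp) fun t => g t D).symm
    rw [h1, sum_filter, Fintype.sum_prod_type]
    simp only [hv]
    rw [mul_div_cancel_left₀ _ (by norm_num : (4 : ℝ) ≠ 0)]
    refine sum_le_sum fun a _ => ?_
    by_cases hex : ∃ p, heavy (a, p) ∧ g (a, p) D ≠ 0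
    · obtain ⟨p, hp, hgp⟩ := hex
      rw [sum_eq_single p (fun q _ hqp => ?_) fun h => absurd (mem_univ p) h]
      · simp only [g]
        split_ifs
        exacts [le_rfl, hw0 a D]
      · split_ifs with hq
        · by_contra h
          exact hqp (huniq a D q p hq.1 hp.1 h hgp)
        · rfl
    · push Not at hex
      rw [sum_eq_zero fun p _ => ?_]
      · exact hw0 a D
      · split_ifs with hp
        exacts [hex p hp, rfl]
  obtain ⟨F, hFinj, hF⟩ := exists_injective_levels hv0 hvlam (fun t : {t // heavy t} => t.1.2)
    (fun t D => inner t D < 1 / 2) (fun t C D h h' => (hinner _ _ _ h).trans_lt h')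
    (g := fun t D => g t D) (fun t D => hg0 _ _)
    (fun t D h => by
      simp only [g, ne_eq, ite_eq_right_iff, not_forall] at h
      exact h.1)
    (fun t => hspread _ t.2) hload
  let f : ι → V → Finset V := fun a p => if h : heavy (a, p) then (F ⟨(a, p), h⟩).1 else univ
  have hfF : ∀ t : {t // heavy t}, f t.1.1 t.1.2 = (F t).1 := fun t => dif_pos t.2
  have hfar : ∀ a p q, p ∈ R a → q ∈ f a p → ∑ D with p ∈ D ∧ q ∉ D, w a D < 1 / 2 := by
    intro a p q hp hq
    by_cases h : heavy (a, p)
    · obtain ⟨hpC, hin, hlev⟩ := hF ⟨(a, p), h⟩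
      rw [hfF ⟨(a, p), h⟩] at hq
      refine lt_of_le_of_lt ?_ hin
      simp only [inner]
      rw [← sum_filter_ne_zero]
      refine sum_le_sum_of_subset_of_nonneg (fun D hD => ?_) fun D _ _ => hw0 a D
      simp only [mem_filter, mem_univ, true_and] at hD ⊢
      have hn : ¬(F ⟨(a, p), h⟩).1 ⊆ D := fun h' => hD.1.2 (h' hq)
      exact ⟨ssubset_of_subset_not_subset ((hvlam.comparable (hwv a D hD.2)
        (ne_zero_of_mem_levels hv0 hlev) hD.1.1 hpC).resolve_right hn) hn, hD.1.1⟩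
    · have h' : ∑ D with p ∈ D, w a D < 1 / 2 := not_le.1 fun h' => h ⟨hp, h'⟩
      refine lt_of_le_of_lt ?_ h'
      exact sum_le_sum_of_subset_of_nonneg (fun D hD => by
        simp only [mem_filter, mem_univ, true_and] at hD ⊢
        exact hD.1) fun D _ _ => hw0 a D
  refine ⟨f, ?_, ?_, ?_⟩
  · intro a p _
    by_cases h : heavy (a, p)
    · rw [hfF ⟨(a, p), h⟩]
      exact (hF ⟨(a, p), h⟩).1
    · simp only [f, dif_neg h, mem_univ]
  · intro a p hp q hq hne
    by_contra! hcon
    have h1 := hfar a p q hp hcon.1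
    have h2 := hfar a q p hq hcon.2
    have h3 : ∑ C, (if Separates C p q then w a C else 0) =
        ∑ D with p ∈ D ∧ q ∉ D, w a D + ∑ D with q ∈ D ∧ p ∉ D, w a D := by
      rw [sum_filter, sum_filter, ← sum_add_distrib]
      refine sum_congr rfl fun C _ => ?_
      by_cases h1 : p ∈ C <;> by_cases h2 : q ∈ C <;> simp [Separates, h1, h2]
    linarith [hsep a p hp q hq hne]
  · intro u z
    have hcard : (univ.filter fun t : ι × V => t.2 ∈ R t.1 ∧ u ∈ f t.1 t.2 ∧ z ∉ f t.1 t.2).card ≤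
        (univ.filter fun t : {t // heavy t} => u ∈ (F t).1 ∧ z ∉ (F t).1).card := by
      rw [← card_map (Function.Embedding.subtype heavy)]
      refine card_le_card fun t ht => ?_
      obtain ⟨-, hu, hz⟩ := (mem_filter.1 ht).2
      have h : heavy t := by
        by_contra h
        exact hz (by simp only [f, dif_neg h, mem_univ])
      refine mem_map.2 ⟨⟨t, h⟩, mem_filter.2 ⟨mem_univ _, ?_⟩, rfl⟩
      rw [hfF ⟨t, h⟩] at hu hz
      exact ⟨hu, hz⟩
    have hlevels := card_levels_le hv0 hvlam
      (univ.filter fun t : {t // heavy t} => u ∈ (F t).1 ∧ z ∉ (F t).1) hFinj u z fun t ht =>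
        ⟨(mem_filter.1 ht).2.1, (mem_filter.1 ht).2.2, (hF t).2.2⟩
    have hsum : ∑ C with u ∈ C ∧ z ∉ C, v C = 4 * ∑ a, ∑ C with u ∈ C ∧ z ∉ C, w a C := by
      rw [sum_comm, mul_sum]
    rw [hsum] at hlevels
    exact (Nat.cast_le.2 hcard).trans hlevels

/-- **Multiway cut packing, main theorem.**
Given a finite simple graph `G` with positive integer edge capacities `c`,
commodities `S 0, …, S (k-1)` (terminals of type `T`, terminal `i` located at
vertex `r i`, distinct terminals of the same commodity at distinct vertices),
if the instance admits a feasible LP solution `d`, then there are multiway cuts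
`F a ⊆ E` (one per commodity) such that every edge `e` lies in at most
`8 * c e + 4` of them. -/
theorem mcp_main
    {V T : Type} [Fintype V] [DecidableEq V] [Fintype T] [DecidableEq T]
    (G : SimpleGraph V) [DecidableRel G.Adj]
    (c : Sym2 V → ℕ) (hc : ∀ e ∈ G.edgeSet, 0 < c e)
    (k : ℕ) (S : Fin k → Finset T) (hcover : ∀ i : T, ∃ a, i ∈ S a)
    (r : T → V)
    (hinj : ∀ a, ∀ i ∈ S a, ∀ j ∈ S a, i ≠ j → r i ≠ r j)
    (d : Fin k → V → V → ℝ)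
    (hd0 : ∀ a u v, 0 ≤ d a u v) (hd1 : ∀ a u v, d a u v ≤ 1)
    (hdrefl : ∀ a u, d a u u = 0)
    (hdsymm : ∀ a u v, d a u v = d a v u)
    (hdtri : ∀ a u v w, d a u v ≤ d a u w + d a w v)
    (hsep : ∀ a, ∀ i ∈ S a, ∀ j ∈ S a, i ≠ j → 1 ≤ d a (r i) (r j))
    (hcap : ∀ u v, G.Adj u v → ∑ a, d a u v ≤ (c s(u, v) : ℝ)) :
    ∃ F : Fin k → Finset (Sym2 V),
      (∀ a, F a ⊆ G.edgeFinset) ∧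
      (∀ a, ∀ i ∈ S a, ∀ j ∈ S a, i ≠ j →
        ¬ (G.deleteEdges ↑(F a)).Reachable (r i) (r j)) ∧
      (∀ e ∈ G.edgeFinset,
        (univ.filter fun a => e ∈ F a).card ≤ 8 * c e + 4) := by
  classical
  let R : Fin k → Finset V := fun a => (S a).image r
  have hR : ∀ a, ∀ p ∈ R a, ∀ q ∈ R a, p ≠ q → 1 ≤ d a p q := by
    intro a p hp q hq hpq
    obtain ⟨i, hi, rfl⟩ := mem_image.1 hp
    obtain ⟨j, hj, rfl⟩ := mem_image.1 hq
    exact hsep a i hi j hj fun h => hpq (h ▸ rfl)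
  obtain ⟨w, hw0, hwsep, hwcross, hwcap⟩ := exists_crossFree_weights R hd0 hdrefl hdsymm hdtri hR
    G.Adj (fun u v => (c s(u, v) : ℝ)) hcap
  obtain ⟨w', hw'0, hlam, hw'⟩ := exists_laminar_weights hw0 hwcross
  obtain ⟨f, hfself, hfsep, hfload⟩ := exists_rounding R hw'0 hlam fun a p hp q hq hpq => by
    rw [hw']
    exact hwsep a p hp q hq hpq
  refine ⟨fun a => G.edgeFinset.filter fun e =>
    ∃ p ∈ R a, ∃ u ∈ f a p, ∃ v, v ∉ f a p ∧ e = s(u, v), fun a => filter_subset _ _, ?_, ?_⟩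
  · intro a i hi j hj hij hreach
    have hne := hinj a i hi j hj hij
    have hi' : r i ∈ R a := mem_image_of_mem r hi
    have hj' : r j ∈ R a := mem_image_of_mem r hj
    have hcut : ∀ p ∈ R a, ∀ q, q ∉ f a p → ¬(G.deleteEdges
        ↑(G.edgeFinset.filter fun e => ∃ p ∈ R a, ∃ u ∈ f a p, ∃ v, v ∉ f a p ∧
          e = s(u, v))).Reachable p q := by
      rintro p hp q hq ⟨walk⟩
      obtain ⟨e, -, h1, h2⟩ := walk.exists_boundary_dart (f a p : Set V)
        (mem_coe.2 (hfself a p hp)) (fun h => hq (mem_coe.1 h))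
      have hadj := e.adj
      rw [SimpleGraph.deleteEdges_adj] at hadj
      exact hadj.2 (mem_coe.2 (mem_filter.2 ⟨SimpleGraph.mem_edgeFinset.2 hadj.1,
        p, hp, _, mem_coe.1 h1, _, fun h => h2 (mem_coe.2 h), rfl⟩))
    rcases hfsep a _ hi' _ hj' hne with h | h
    · exact hcut _ hi' _ h hreach
    · exact hcut _ hj' _ h hreach.symm
  · intro e he
    induction e using Sym2.ind with | _ u v => ?_
    have hadj : G.Adj u v := SimpleGraph.mem_edgeFinset.1 he
    have hsub : (univ.filter fun a => s(u, v) ∈ G.edgeFinset.filter fun e =>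
        ∃ p ∈ R a, ∃ u ∈ f a p, ∃ v, v ∉ f a p ∧ e = s(u, v)) ⊆
        ((univ.filter fun t : Fin k × V => t.2 ∈ R t.1 ∧ u ∈ f t.1 t.2 ∧ v ∉ f t.1 t.2) ∪
          univ.filter fun t : Fin k × V =>
            t.2 ∈ R t.1 ∧ v ∈ f t.1 t.2 ∧ u ∉ f t.1 t.2).image Prod.fst := by
      intro a ha
      obtain ⟨p, hp, u', hu', v', hv', heq⟩ := (mem_filter.1 (mem_filter.1 ha).2).2
      refine mem_image.2 ⟨(a, p), ?_, rfl⟩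
      rcases Sym2.eq_iff.1 heq with ⟨rfl, rfl⟩ | ⟨rfl, rfl⟩
      · exact mem_union_left _ (mem_filter.2 ⟨mem_univ _, hp, hu', hv'⟩)
      · exact mem_union_right _ (mem_filter.2 ⟨mem_univ _, hp, hu', hv'⟩)
    have hcard := (card_le_card hsub).trans (card_image_le.trans (card_union_le _ _))
    have hsum : ∑ a, ∑ C with u ∈ C ∧ v ∉ C, w' a C + ∑ a, ∑ C with v ∈ C ∧ u ∉ C, w' a C =
        ∑ a, ∑ C, if Separates C u v then w a C else 0 := by
      rw [← sum_add_distrib]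
      refine sum_congr rfl fun a _ => ?_
      rw [← hw', sum_filter, sum_filter, ← sum_add_distrib]
      refine sum_congr rfl fun C _ => ?_
      by_cases h1 : u ∈ C <;> by_cases h2 : v ∈ C <;> simp [Separates, h1, h2]
    have h1 := hfload u v
    have h2 := hfload v u
    have h3 := hwcap u v hadj
    have h4 := (Nat.cast_le (α := ℝ)).2 hcard
    rw [Nat.cast_add] at h4
    refine (Nat.cast_le (α := ℝ)).1 ?_
    push_cast
    linarith
end

section
/- Let G=(V,E) be a finite simple undirected graph with positive integer edge capacities c_e, a sink vertex t, and source terminals at vertices r_1,…,r_k with r_a ≠ t for each a (the a-th commodity is the pair {r_a,t}). Suppose there exist functions d_a : V×V → [0,1] for a=1,…,k with d_a(u,u)=0, d_a(u,v)=d_a(v,u), d_a(u,v) ≤ d_a(u,w)+d_a(w,v) for all u,v,w ∈ V, d_a(r_a,t) ≥ 1 for each a, and Σ_a d_a(u,v) ≤ c_e for every edge e={u,v}. Then there exist subsets A_1,…,A_k ⊆ V with r_a ∈ A_a and t ∉ A_a for every a, such that every edge e of G belongs to δ(A_a) for at most c_e + 2 indices a. -/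
open Finset

namespace CutPacking

variable {V ι : Type*} [DecidableEq V] [Fintype ι]

/-- The number of terminals in `X` minus the total weight of the family `F`. -/
def slack (r : ι → V) (Y : Finset V → ℝ) (F : Finset (Finset V)) (X : Finset V) : ℝ :=
  #{a | r a ∈ X} - ∑ T ∈ F, Y T

/-- A choice of cuts inside `X`, where `A a = ∅` means that terminal `a` is not yet served.
Exactly `g` terminals of `X` are not served, and every directed load exceeds the fractional
one by at most `1`. -/
structure PartialPacking (r : ι → V) (Y : Finset V → ℝ) (F : Finset (Finset V)) (X : Finset V)
    (g : ℕ) (A : ι → Finset V) : Prop where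
  mem : ∀ a, (A a).Nonempty → r a ∈ A a
  sub : ∀ a, A a ⊆ X
  card : #{a | r a ∈ X ∧ A a = ∅} = g
  load : ∀ u v, (#{a | u ∈ A a ∧ v ∉ A a} : ℝ) ≤ ∑ T ∈ F with u ∈ T ∧ v ∉ T, Y T + 1

/-- The number of cuts containing any vertex exceeds the fractional value by at most
`slack r Y F X - g`. -/
def TopBound (r : ι → V) (Y : Finset V → ℝ) (F : Finset (Finset V)) (X : Finset V)
    (g : ℕ) (A : ι → Finset V) : Prop :=
  ∀ u, (#{a | u ∈ A a} : ℝ) ≤ ∑ T ∈ F with u ∈ T, Y T + (slack r Y F X - g)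

/-- All numbers of unserved terminals between `l` and the rounded-up slack are achievable, and
`l` itself is achievable with `TopBound`. -/
def Roundable (r : ι → V) (Y : Finset V → ℝ) (F : Finset (Finset V)) (X : Finset V) : Prop :=
  ∃ l : ℕ, (l : ℝ) ≤ slack r Y F X ∧
    (∃ A, PartialPacking r Y F X l A ∧ TopBound r Y F X l A) ∧
    ∀ g : ℕ, l ≤ g → (g : ℝ) < slack r Y F X + 1 → ∃ A, PartialPacking r Y F X g A

/-- Any two members of the family are nested or disjoint. -/
def Laminar (F : Finset (Finset V)) : Prop :=
  ∀ S ∈ F, ∀ T ∈ F, S ⊆ T ∨ T ⊆ S ∨ Disjoint S T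

variable {r : ι → V} {Y : Finset V → ℝ} {F F₁ F₂ : Finset (Finset V)} {X X₁ X₂ : Finset V}

lemma roundable_empty : Roundable r Y ∅ X := by
  have key : PartialPacking r Y ∅ X #{a | r a ∈ X} fun _ => ∅ :=
    ⟨by simp, by simp, by simp, by simp⟩
  refine ⟨#{a | r a ∈ X}, by simp [slack], ⟨_, key, by simp [TopBound, slack]⟩, ?_⟩
  intro g h1 h2
  have h3 : (g : ℝ) < (#{a | r a ∈ X} + 1 : ℕ) := by simpa [slack] using h2
  have h4 : g < #{a | r a ∈ X} + 1 := by exact_mod_cast h3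
  obtain rfl : g = #{a | r a ∈ X} := by omega
  exact ⟨_, key⟩

lemma slack_insert (hX : X ∉ F) : slack r Y (insert X F) X = slack r Y F X - Y X := by
  simp only [slack, sum_insert hX]; ring

lemma slack_union (hX : Disjoint X₁ X₂) (hF : Disjoint F₁ F₂) :
    slack r Y (F₁ ∪ F₂) (X₁ ∪ X₂) = slack r Y F₁ X₁ + slack r Y F₂ X₂ := by
  classical
  have h : ({a | r a ∈ X₁ ∪ X₂} : Finset ι) =
      ({a | r a ∈ X₁} : Finset ι) ∪ ({a | r a ∈ X₂} : Finset ι) := by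
    ext; simp
  have hd : Disjoint ({a | r a ∈ X₁} : Finset ι) ({a | r a ∈ X₂} : Finset ι) :=
    disjoint_filter.2 fun a _ h1 h2 => disjoint_left.1 hX h1 h2
  simp only [slack, sum_union hF, h, card_union_of_disjoint hd]
  push_cast; ring

lemma roundable_insert (hY : ∀ T, 0 ≤ Y T) (hXF : X ∉ F) (hF : ∀ T ∈ F, T ⊆ X) (hne : X.Nonempty)
    (hs : 0 ≤ slack r Y (insert X F) X) (h : Roundable r Y F X) :
    Roundable r Y (insert X F) X := by
  obtain ⟨l, hl, ⟨A, hA, hTop⟩, hg⟩ := h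
  have hsl := slack_insert (r := r) (Y := Y) hXF
  have hYX := hY X
  have lift : ∀ {g B}, PartialPacking r Y F X g B → PartialPacking r Y (insert X F) X g B := by
    intro g B hB
    refine ⟨hB.mem, hB.sub, hB.card, fun u v => (hB.load u v).trans ?_⟩
    gcongr
    · exact fun _ _ _ => hY _
    · exact subset_insert _ _
  have sum_top : ∀ u ∈ X, ∑ T ∈ insert X F with u ∈ T, Y T = Y X + ∑ T ∈ F with u ∈ T, Y T := by
    intro u hu
    rw [filter_insert, if_pos hu, sum_insert (by simp [hXF])]
  by_cases hcase : (l : ℝ) ≤ slack r Y (insert X F) X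
  · refine ⟨l, hcase, ⟨A, lift hA, fun u => ?_⟩, fun g h1 h2 => ?_⟩
    · by_cases hu : u ∈ X
      · have := hTop u
        rw [sum_top u hu]; linarith
      · have h0 : #{a | u ∈ A a} = 0 := by
          simp only [card_eq_zero, filter_eq_empty_iff]
          exact fun a _ h => hu (hA.sub a h)
        rw [h0]
        have : 0 ≤ ∑ T ∈ insert X F with u ∈ T, Y T := sum_nonneg fun _ _ => hY _
        push_cast; linarith
    · obtain ⟨B, hB⟩ := hg g h1 (by linarith)
      exact ⟨B, lift hB⟩
  · push Not at hcase
    have key : ∀ g : ℕ, g ≤ l → slack r Y (insert X F) X ≤ g + 1 →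
        ∃ B, PartialPacking r Y (insert X F) X g B ∧
          ((g : ℝ) ≤ slack r Y (insert X F) X → TopBound r Y (insert X F) X g B) := by
      intro g hgl hgs
      obtain ⟨W, hWU, hW⟩ := exists_subset_card_eq
        (s := ({a | r a ∈ X ∧ A a = ∅} : Finset ι)) (n := l - g) (by rw [hA.card]; omega)
      have hW' : ∀ a ∈ W, r a ∈ X ∧ A a = ∅ := fun a ha => by simpa using hWU ha
      classical
      set B : ι → Finset V := fun a => if a ∈ W then X else A a with hB
      have hBsub : ∀ a, B a ⊆ X := by
        intro a; simp only [hB]; split_ifs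
        · exact Subset.rfl
        · exact hA.sub a
      have hcard : (#W : ℝ) = l - g := by rw [hW, Nat.cast_sub hgl]
      have top : ∀ u ∈ X, (#{a | u ∈ B a} : ℝ) ≤
          ∑ T ∈ insert X F with u ∈ T, Y T + (slack r Y (insert X F) X - g) := by
        intro u hu
        have h1 : ({a | u ∈ B a} : Finset ι) ⊆ W ∪ ({a | u ∈ A a} : Finset ι) := by
          intro a; simp only [hB, mem_filter, mem_univ, true_and, mem_union]
          split_ifs <;> tauto
        have h2 : (#{a | u ∈ B a} : ℝ) ≤ #W + #{a | u ∈ A a} := by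
          exact_mod_cast (card_le_card h1).trans (card_union_le _ _)
        have := hTop u
        rw [sum_top u hu]; linarith
      refine ⟨B, ⟨?_, hBsub, ?_, ?_⟩, ?_⟩
      · intro a; simp only [hB]; split_ifs with h
        · exact fun _ => (hW' a h).1
        · exact hA.mem a
      · have : ({a | r a ∈ X ∧ B a = ∅} : Finset ι) =
            ({a | r a ∈ X ∧ A a = ∅} : Finset ι) \ W := by
          ext a; simp only [hB, mem_filter, mem_univ, true_and, mem_sdiff]
          split_ifs with h <;> simp [h, hne.ne_empty]
        rw [this, card_sdiff_of_subset hWU, hA.card, hW]; omega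
      · intro u v
        by_cases hu : u ∈ X
        · by_cases hv : v ∈ X
          · have h1 : ({a | u ∈ B a ∧ v ∉ B a} : Finset ι) ⊆
                ({a | u ∈ A a ∧ v ∉ A a} : Finset ι) := by
              intro a; simp only [hB, mem_filter, mem_univ, true_and]
              split_ifs <;> tauto
            exact (Nat.cast_le.2 (card_le_card h1)).trans ((lift hA).load u v)
          · have h1 : ({a | u ∈ B a ∧ v ∉ B a} : Finset ι) ⊆ ({a | u ∈ B a} : Finset ι) :=
              fun a => by simp +contextual
            have h2 : ({T ∈ insert X F | u ∈ T ∧ v ∉ T} : Finset (Finset V)) =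
                {T ∈ insert X F | u ∈ T} := by
              refine filter_congr fun T hT => and_iff_left fun hvT => hv ?_
              rcases mem_insert.1 hT with rfl | hT
              · exact hvT
              · exact hF T hT hvT
            rw [h2]
            have h3 : (#{a | u ∈ B a ∧ v ∉ B a} : ℝ) ≤ #{a | u ∈ B a} :=
              Nat.cast_le.2 (card_le_card h1)
            linarith [top u hu]
        · have h0 : #{a | u ∈ B a ∧ v ∉ B a} = 0 := by
            simp only [card_eq_zero, filter_eq_empty_iff]
            exact fun a _ h => hu (hBsub a h.1)
          rw [h0]
          have : 0 ≤ ∑ T ∈ insert X F with u ∈ T ∧ v ∉ T, Y T := sum_nonneg fun _ _ => hY _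
          push_cast; linarith
      · intro hgs' u
        by_cases hu : u ∈ X
        · exact top u hu
        · have h0 : #{a | u ∈ B a} = 0 := by
            simp only [card_eq_zero, filter_eq_empty_iff]
            exact fun a _ h => hu (hBsub a h)
          rw [h0]
          have : 0 ≤ ∑ T ∈ insert X F with u ∈ T, Y T := sum_nonneg fun _ _ => hY _
          push_cast; linarith
    have hfl := Nat.floor_le hs
    have hfl' := Nat.lt_floor_add_one (slack r Y (insert X F) X)
    refine ⟨⌊slack r Y (insert X F) X⌋₊, hfl, ?_, fun g h1 h2 => ?_⟩
    · have : ⌊slack r Y (insert X F) X⌋₊ ≤ l := by exact_mod_cast hfl.trans hcase.le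
      obtain ⟨B, hB, hB'⟩ := key _ this hfl'.le
      exact ⟨B, hB, hB' hfl⟩
    · rcases le_total l g with h | h
      · obtain ⟨B, hB⟩ := hg g h (by linarith)
        exact ⟨B, lift hB⟩
      · have h1' : (⌊slack r Y (insert X F) X⌋₊ : ℝ) ≤ g := by exact_mod_cast h1
        obtain ⟨B, hB, -⟩ := key g h (by linarith)
        exact ⟨B, hB⟩

lemma PartialPacking.union (hY : ∀ T, 0 ≤ Y T) (hX : Disjoint X₁ X₂) {g₁ g₂ : ℕ}
    {A₁ A₂ : ι → Finset V} (h₁ : PartialPacking r Y F₁ X₁ g₁ A₁)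
    (h₂ : PartialPacking r Y F₂ X₂ g₂ A₂) :
    PartialPacking r Y (F₁ ∪ F₂) (X₁ ∪ X₂) (g₁ + g₂)
      (fun a => if r a ∈ X₁ then A₁ a else A₂ a) := by
  classical
  have hX' : ∀ x ∈ X₁, x ∉ X₂ := fun x h => disjoint_left.1 hX h
  refine ⟨?_, ?_, ?_, ?_⟩
  · intro a; split_ifs
    · exact h₁.mem a
    · exact h₂.mem a
  · intro a; split_ifs
    · exact (h₁.sub a).trans subset_union_left
    · exact (h₂.sub a).trans subset_union_right
  · rw [← h₁.card, ← h₂.card, ← card_union_of_disjoint]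
    · congr 1
      ext a
      have := hX' (r a)
      simp only [mem_filter, mem_univ, true_and, mem_union]
      split_ifs <;> tauto
    · exact disjoint_filter.2 fun a _ h h' => hX' _ h.1 h'.1
  · intro u v
    by_cases hu : u ∈ X₁
    · have h : ({a | u ∈ (if r a ∈ X₁ then A₁ a else A₂ a) ∧
          v ∉ (if r a ∈ X₁ then A₁ a else A₂ a)} : Finset ι) ⊆
          ({a | u ∈ A₁ a ∧ v ∉ A₁ a} : Finset ι) := by
        intro a
        have := hX' u hu
        have := @h₂.sub a u
        simp only [mem_filter, mem_univ, true_and]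
        split_ifs <;> tauto
      refine (Nat.cast_le.2 (card_le_card h)).trans ((h₁.load u v).trans ?_)
      gcongr
      · exact fun _ _ _ => hY _
      · exact subset_union_left
    · have h : ({a | u ∈ (if r a ∈ X₁ then A₁ a else A₂ a) ∧
          v ∉ (if r a ∈ X₁ then A₁ a else A₂ a)} : Finset ι) ⊆
          ({a | u ∈ A₂ a ∧ v ∉ A₂ a} : Finset ι) := by
        intro a
        have := @h₁.sub a u
        simp only [mem_filter, mem_univ, true_and]
        split_ifs <;> tauto
      refine (Nat.cast_le.2 (card_le_card h)).trans ((h₂.load u v).trans ?_)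
      gcongr
      · exact fun _ _ _ => hY _
      · exact subset_union_right

lemma TopBound.union (hY : ∀ T, 0 ≤ Y T) (hX : Disjoint X₁ X₂) (hF : Disjoint F₁ F₂) {g₁ g₂ : ℕ}
    (hs₁ : g₁ ≤ slack r Y F₁ X₁) (hs₂ : g₂ ≤ slack r Y F₂ X₂)
    {A₁ A₂ : ι → Finset V} (h₁ : PartialPacking r Y F₁ X₁ g₁ A₁)
    (h₂ : PartialPacking r Y F₂ X₂ g₂ A₂) (ht₁ : TopBound r Y F₁ X₁ g₁ A₁)
    (ht₂ : TopBound r Y F₂ X₂ g₂ A₂) :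
    TopBound r Y (F₁ ∪ F₂) (X₁ ∪ X₂) (g₁ + g₂)
      (fun a => if r a ∈ X₁ then A₁ a else A₂ a) := by
  have hX' : ∀ x ∈ X₁, x ∉ X₂ := fun x h => disjoint_left.1 hX h
  intro u
  rw [slack_union hX hF]
  by_cases hu : u ∈ X₁
  · have h : ({a | u ∈ (if r a ∈ X₁ then A₁ a else A₂ a)} : Finset ι) ⊆
        ({a | u ∈ A₁ a} : Finset ι) := by
      intro a
      have := hX' u hu
      have := @h₂.sub a u
      simp only [mem_filter, mem_univ, true_and]
      split_ifs <;> tauto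
    have hsum : ∑ T ∈ F₁ with u ∈ T, Y T ≤ ∑ T ∈ F₁ ∪ F₂ with u ∈ T, Y T := by
      gcongr
      · exact fun _ _ _ => hY _
      · exact subset_union_left
    refine (Nat.cast_le.2 (card_le_card h)).trans ((ht₁ u).trans ?_)
    push_cast; linarith
  · have h : ({a | u ∈ (if r a ∈ X₁ then A₁ a else A₂ a)} : Finset ι) ⊆
        ({a | u ∈ A₂ a} : Finset ι) := by
      intro a
      have := @h₁.sub a u
      simp only [mem_filter, mem_univ, true_and]
      split_ifs <;> tauto
    have hsum : ∑ T ∈ F₂ with u ∈ T, Y T ≤ ∑ T ∈ F₁ ∪ F₂ with u ∈ T, Y T := by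
      gcongr
      · exact fun _ _ _ => hY _
      · exact subset_union_right
    refine (Nat.cast_le.2 (card_le_card h)).trans ((ht₂ u).trans ?_)
    push_cast; linarith

lemma roundable_union (hY : ∀ T, 0 ≤ Y T) (hX : Disjoint X₁ X₂) (hF : Disjoint F₁ F₂)
    (h₁ : Roundable r Y F₁ X₁) (h₂ : Roundable r Y F₂ X₂) :
    Roundable r Y (F₁ ∪ F₂) (X₁ ∪ X₂) := by
  obtain ⟨l₁, hl₁, ⟨A₁, hA₁, ht₁⟩, hg₁⟩ := h₁
  obtain ⟨l₂, hl₂, ⟨A₂, hA₂, ht₂⟩, hg₂⟩ := h₂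
  have hsl := slack_union (r := r) (Y := Y) hX hF
  refine ⟨l₁ + l₂, by rw [hsl]; push_cast; linarith,
    ⟨_, hA₁.union hY hX hA₂, TopBound.union hY hX hF hl₁ hl₂ hA₁ hA₂ ht₁ ht₂⟩, fun g h1 h2 => ?_⟩
  rw [hsl] at h2
  have hc₁ := Nat.ceil_lt_add_one ((Nat.cast_nonneg l₁).trans hl₁)
  have hc₂ := Nat.ceil_lt_add_one ((Nat.cast_nonneg l₂).trans hl₂)
  have hd₁ := Nat.le_ceil (slack r Y F₁ X₁)
  have hd₂ := Nat.le_ceil (slack r Y F₂ X₂)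
  have hle₁ : l₁ ≤ ⌈slack r Y F₁ X₁⌉₊ := by exact_mod_cast hl₁.trans hd₁
  have hle₂ : l₂ ≤ ⌈slack r Y F₂ X₂⌉₊ := by exact_mod_cast hl₂.trans hd₂
  have hg : g < ⌈slack r Y F₁ X₁⌉₊ + ⌈slack r Y F₂ X₂⌉₊ + 1 := by
    have : (g : ℝ) < (⌈slack r Y F₁ X₁⌉₊ + ⌈slack r Y F₂ X₂⌉₊ + 1 : ℕ) := by
      push_cast; linarith
    exact_mod_cast this
  obtain ⟨g₁, g₂, rfl, ha, hb, hc, hd⟩ : ∃ g₁ g₂, g = g₁ + g₂ ∧ l₁ ≤ g₁ ∧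
      g₁ ≤ ⌈slack r Y F₁ X₁⌉₊ ∧ l₂ ≤ g₂ ∧ g₂ ≤ ⌈slack r Y F₂ X₂⌉₊ :=
    ⟨min ⌈slack r Y F₁ X₁⌉₊ (g - l₂), g - min ⌈slack r Y F₁ X₁⌉₊ (g - l₂), by omega, by omega,
      by omega, by omega, by omega⟩
  obtain ⟨B₁, hB₁⟩ := hg₁ g₁ ha ((Nat.cast_le.2 hb).trans_lt hc₁)
  obtain ⟨B₂, hB₂⟩ := hg₂ g₂ hc ((Nat.cast_le.2 hd).trans_lt hc₂)
  exact ⟨_, hB₁.union hY hX hB₂⟩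

theorem Laminar.roundable (hY : ∀ T, 0 ≤ Y T) (hF : Laminar F) (hsub : ∀ T ∈ F, T ⊆ X)
    (hne : ∀ T ∈ F, T.Nonempty)
    (hall : ∀ S ∈ F, ∑ T ∈ F with T ⊆ S, Y T ≤ #{a | r a ∈ S}) :
    Roundable r Y F X := by
  induction hn : #F + #X using Nat.strong_induction_on generalizing F X with
  | _ n ih =>
  have mono : ∀ {F'}, F' ⊆ F → ∀ S ∈ F', ∑ T ∈ F' with T ⊆ S, Y T ≤ #{a | r a ∈ S} := by
    intro F' hF' S hS
    refine le_trans ?_ (hall S (hF' hS))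
    gcongr
    exact fun _ _ _ => hY _
  have lam : ∀ {F'}, F' ⊆ F → Laminar F' := fun hF' S hS T hT => hF S (hF' hS) T (hF' hT)
  by_cases hXF : X ∈ F
  · rw [← insert_erase hXF]
    have hsub' : F.erase X ⊆ F := erase_subset _ _
    have hcard := card_erase_lt_of_mem hXF
    refine roundable_insert hY (notMem_erase _ _) (fun T hT => hsub T (hsub' hT)) (hne X hXF) ?_
      (ih _ (by omega) (lam hsub') (fun T hT => hsub T (hsub' hT))
        (fun T hT => hne T (hsub' hT)) (mono hsub') rfl)
    rw [insert_erase hXF]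
    have := hall X hXF
    rw [filter_true_of_mem hsub] at this
    exact sub_nonneg.2 this
  · rcases F.eq_empty_or_nonempty with rfl | hFne
    · exact roundable_empty
    · obtain ⟨S, hS⟩ := F.exists_maximal hFne
      have hSF := hS.prop
      have hSX : S ⊂ X := (hsub S hSF).ssubset_of_ne fun h => hXF (h ▸ hSF)
      have hc1 := card_lt_card hSX
      have hc2 := card_sdiff_add_card_eq_card (hsub S hSF)
      have hc3 := (hne S hSF).card_pos
      have hf1 : {T ∈ F | T ⊆ S} ⊆ F := filter_subset _ _
      have hf2 : {T ∈ F | ¬ T ⊆ S} ⊆ F := filter_subset _ _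
      have hc4 := card_le_card hf1
      have hc5 := card_le_card hf2
      rw [← filter_union_filter_not_eq (fun T => T ⊆ S) F, ← union_sdiff_of_subset (hsub S hSF)]
      refine roundable_union hY disjoint_sdiff (disjoint_filter_filter_not _ _ _)
        (ih _ (by omega) (lam hf1) (fun T hT => (mem_filter.1 hT).2)
          (fun T hT => hne T (hf1 hT)) (mono hf1) rfl)
        (ih _ (by omega) (lam hf2) (fun T hT => ?_)
          (fun T hT => hne T (hf2 hT)) (mono hf2) rfl)
      obtain ⟨hTF, hTS⟩ := mem_filter.1 hT
      rcases hF T hTF S hSF with h | h | h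
      · exact absurd h hTS
      · exact absurd (hS.le_of_ge hTF h) hTS
      · exact subset_sdiff.2 ⟨hsub T hTF, h⟩

/-- A laminar fractional packing whose total weight is the number of terminals can be rounded to
one cut per terminal, with every directed load increased by at most `1`. -/
theorem Laminar.exists_cuts (hY : ∀ T, 0 ≤ Y T) (hF : Laminar F) (hsub : ∀ T ∈ F, T ⊆ X)
    (hne : ∀ T ∈ F, T.Nonempty) (hr : ∀ a, r a ∈ X)
    (hall : ∀ S ∈ F, ∑ T ∈ F with T ⊆ S, Y T ≤ #{a | r a ∈ S})
    (htot : ∑ T ∈ F, Y T = Fintype.card ι) :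
    ∃ A : ι → Finset V, (∀ a, r a ∈ A a ∧ A a ⊆ X) ∧
      ∀ u v, (#{a | u ∈ A a ∧ v ∉ A a} : ℝ) ≤ ∑ T ∈ F with u ∈ T ∧ v ∉ T, Y T + 1 := by
  obtain ⟨l, hl, ⟨A, hA, -⟩, -⟩ := hF.roundable hY hsub hne hall
  have hs : slack r Y F X = 0 := by simp [slack, hr, htot]
  have hl0 : l = 0 := by
    rw [hs] at hl
    exact_mod_cast le_antisymm hl (Nat.cast_nonneg l)
  have hcard := hA.card
  simp only [hl0, hr, true_and, card_eq_zero, filter_eq_empty_iff, mem_univ,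
    forall_const] at hcard
  exact ⟨A, fun a => ⟨hA.mem a (nonempty_iff_ne_empty.2 (hcard (x := a))), hA.sub a⟩, hA.load⟩

/-- The indicator that `u` and `v` are separated by `S`. -/
def cut (u v : V) (S : Finset V) : ℝ := if u ∈ S ↔ v ∈ S then 0 else 1

lemma cut_inter_add_cut_union_le (u v : V) (S T : Finset V) :
    cut u v (S ∩ T) + cut u v (S ∪ T) ≤ cut u v S + cut u v T := by
  by_cases h1 : u ∈ S <;> by_cases h2 : u ∈ T <;> by_cases h3 : v ∈ S <;> by_cases h4 : v ∈ T <;>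
    simp [cut, h1, h2, h3, h4]

lemma cut_sdiff_add_cut_sdiff_le (u v : V) (S T : Finset V) :
    cut u v (S \ T) + cut u v (T \ S) ≤ cut u v S + cut u v T := by
  by_cases h1 : u ∈ S <;> by_cases h2 : u ∈ T <;> by_cases h3 : v ∈ S <;> by_cases h4 : v ∈ T <;>
    simp [cut, h1, h2, h3, h4]

section Fractional

variable [Fintype V] {r : ι → V} {t : V} {b : V → V → ℝ} {y : ι × Finset V → ℝ}

/-- A fractional common-sink cut packing: for each commodity `a`, a probability distribution
`y (a, ·)` on the sets separating `r a` from `t`, with total load on `u`, `v` at most `b u v`. -/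
structure FracPacking (r : ι → V) (t : V) (b : V → V → ℝ) (y : ι × Finset V → ℝ) : Prop where
  nonneg : ∀ p, 0 ≤ y p
  sum_eq : ∀ a, ∑ S, y (a, S) = 1
  supp : ∀ p, ¬(r p.1 ∈ p.2 ∧ t ∉ p.2) → y p = 0
  load : ∀ u v, ∑ p, y p * cut u v p.2 ≤ b u v

lemma isCompact_fracPacking (r : ι → V) (t : V) (b : V → V → ℝ) :
    IsCompact {y | FracPacking r t b y} := by
  refine (isCompact_univ_pi fun _ : ι × Finset V =>
    isCompact_Icc (a := (0 : ℝ)) (b := 1)).of_isClosed_subset ?_ fun y hy p _ => ⟨hy.nonneg p, ?_⟩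
  · have : {y | FracPacking r t b y} = (⋂ p, {y | 0 ≤ y p}) ∩ (⋂ a, {y | ∑ S, y (a, S) = 1}) ∩
        (⋂ p, ⋂ (_ : ¬(r p.1 ∈ p.2 ∧ t ∉ p.2)), {y | y p = 0}) ∩
        ⋂ u, ⋂ v, {y | ∑ p, y p * cut u v p.2 ≤ b u v} := by
      ext y
      simp only [Set.mem_inter_iff, Set.mem_iInter, Set.mem_ofPred_eq]
      exact ⟨fun h => ⟨⟨⟨h.1, h.2⟩, h.3⟩, h.4⟩, fun h => ⟨h.1.1.1, h.1.1.2, h.1.2, h.2⟩⟩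
    rw [this]
    refine (((isClosed_iInter fun p => ?_).inter (isClosed_iInter fun a => ?_)).inter
      (isClosed_iInter fun p => isClosed_iInter fun _ => ?_)).inter
      (isClosed_iInter fun u => isClosed_iInter fun v => ?_)
    · exact isClosed_le (by fun_prop) (by fun_prop)
    · exact isClosed_eq (by fun_prop) (by fun_prop)
    · exact isClosed_eq (by fun_prop) (by fun_prop)
    · exact isClosed_le (by fun_prop) (by fun_prop)
  · rw [← hy.sum_eq p.1]
    exact single_le_sum (f := fun S => y (p.1, S)) (fun S _ => hy.nonneg _) (mem_univ p.2)

/-- A strictly increasing and strictly concave function of the size of a set. -/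
def weight (S : Finset V) : ℝ := #S * (2 * Fintype.card V - #S)

/-- In a packing of minimum weight, no exchange of two cuts for two others that keeps
feasibility can lower the weight. -/
lemma FracPacking.weight_le_of_exchange (hy : FracPacking r t b y)
    (hmin : ∀ y', FracPacking r t b y' → ∑ p, y p * weight p.2 ≤ ∑ p, y' p * weight p.2)
    {i j : ι} {S T S' T' : Finset V} (hne : (i, S) ≠ (j, T)) (hS : 0 < y (i, S))
    (hT : 0 < y (j, T)) (hS' : r i ∈ S' ∧ t ∉ S') (hT' : r j ∈ T' ∧ t ∉ T')
    (hcut : ∀ u v, cut u v S' + cut u v T' ≤ cut u v S + cut u v T) :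
    weight S + weight T ≤ weight S' + weight T' := by
  classical
  set ε := min (y (i, S)) (y (j, T)) with hε
  have hε0 : 0 < ε := lt_min hS hT
  let δ : ι × Finset V → ι × Finset V → ℝ := fun p q => if q = p then 1 else 0
  have hδ : ∀ p q, 0 ≤ δ p q := fun p q => by simp only [δ]; split_ifs <;> norm_num
  set y' : ι × Finset V → ℝ := fun q =>
    y q + ε * (δ (i, S') q + δ (j, T') q - δ (i, S) q - δ (j, T) q) with hy'
  have hsum : ∀ φ : ι × Finset V → ℝ, ∑ q, y' q * φ q =
      ∑ q, y q * φ q + ε * (φ (i, S') + φ (j, T') - φ (i, S) - φ (j, T)) := by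
    intro φ
    have h1 : ∀ p, ∑ q, δ p q * φ q = φ p := fun p => by simp [δ]
    rw [← h1 (i, S'), ← h1 (j, T'), ← h1 (i, S), ← h1 (j, T), ← sum_add_distrib,
      ← sum_sub_distrib, ← sum_sub_distrib, mul_sum, ← sum_add_distrib]
    exact sum_congr rfl fun q _ => by simp only [hy']; ring
  have hrow : ∀ (z : ι × Finset V → ℝ) (a : ι),
      ∑ U, z (a, U) = ∑ q, z q * (if q.1 = a then 1 else 0) := by
    intro z a
    rw [Fintype.sum_prod_type, Finset.sum_comm]
    simp
  have hfeas : FracPacking r t b y' := by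
    refine ⟨fun q => ?_, fun a => ?_, fun q hq => ?_, fun u v => ?_⟩
    · have h1 : 0 ≤ ε * (δ (i, S') q + δ (j, T') q) :=
        mul_nonneg hε0.le (add_nonneg (hδ _ _) (hδ _ _))
      have h2 : ε * (δ (i, S) q + δ (j, T) q) ≤ y q := by
        by_cases hq1 : q = (i, S)
        · subst hq1
          simp [δ, hne, show ε ≤ y (i, S) from min_le_left _ _]
        · by_cases hq2 : q = (j, T)
          · subst hq2
            simp [δ, hq1, show ε ≤ y (j, T) from min_le_right _ _]
          · simpa [δ, hq1, hq2] using hy.nonneg q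
      simp only [hy']; linarith
    · rw [hrow, hsum, ← hrow, hy.sum_eq]; simp
    · have hne' : ∀ p : ι × Finset V, (r p.1 ∈ p.2 ∧ t ∉ p.2) → δ p q = 0 := fun p hp =>
        if_neg fun h => hq (by rwa [h])
      have h3 : ∀ p, 0 < y p → δ p q = 0 := fun p hp =>
        if_neg fun h => hp.ne' (by rw [← h, hy.supp q hq])
      simp only [hy', hne' (i, S') hS', hne' (j, T') hT', h3 _ hS, h3 _ hT, hy.supp q hq]
      ring
    · rw [hsum]
      have := mul_nonneg hε0.le (sub_nonneg.2 (hcut u v))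
      have := hy.load u v
      dsimp only
      linarith
  have h := hmin y' hfeas
  rw [hsum] at h
  have h' : 0 ≤ weight S' + weight T' - weight S - weight T :=
    nonneg_of_mul_nonneg_right (by dsimp only at h; linarith) hε0
  linarith

lemma weight_inter_add_weight_union_lt {S T : Finset V} (h₁ : ¬S ⊆ T) (h₂ : ¬T ⊆ S) :
    weight (S ∩ T) + weight (S ∪ T) < weight S + weight T := by
  have e : (#(S ∪ T) : ℝ) = #S + #T - #(S ∩ T) := by
    rw [eq_sub_iff_add_eq]; exact_mod_cast card_union_add_card_inter S T
  have l₁ : (#(S ∩ T) : ℝ) < #S := by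
    exact_mod_cast card_lt_card (inter_subset_left.ssubset_of_ne fun h => h₁ (inter_eq_left.1 h))
  have l₂ : (#(S ∩ T) : ℝ) < #T := by
    exact_mod_cast card_lt_card (inter_subset_right.ssubset_of_ne fun h => h₂ (inter_eq_right.1 h))
  simp only [weight, e]
  nlinarith [mul_pos (sub_pos.2 l₁) (sub_pos.2 l₂)]

lemma weight_sdiff_lt {S T : Finset V} (h : ¬Disjoint S T) : weight (S \ T) < weight S := by
  have e : (#(S \ T) : ℝ) + #(S ∩ T) = #S := by exact_mod_cast card_sdiff_add_card_inter S T
  have hpos : (0 : ℝ) < #(S ∩ T) := by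
    exact_mod_cast (not_disjoint_iff_nonempty_inter.1 h).card_pos
  have hV : (#S : ℝ) ≤ Fintype.card V := by exact_mod_cast card_le_univ S
  have h0 : (0 : ℝ) ≤ #(S \ T) := Nat.cast_nonneg _
  simp only [weight, ← e]
  rw [← e] at hV
  nlinarith [mul_pos hpos hpos, mul_nonneg hpos.le (sub_nonneg.2 hV)]

/-- The sets in the support of a packing of minimum weight are pairwise nested or disjoint. -/
lemma FracPacking.nested_or_disjoint (hy : FracPacking r t b y)
    (hmin : ∀ y', FracPacking r t b y' → ∑ p, y p * weight p.2 ≤ ∑ p, y' p * weight p.2)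
    {i j : ι} {S T : Finset V} (hS : 0 < y (i, S)) (hT : 0 < y (j, T)) :
    S ⊆ T ∨ T ⊆ S ∨ Disjoint S T := by
  by_contra! hcon
  obtain ⟨h₁, h₂, h₃⟩ := hcon
  have hne : (i, S) ≠ (j, T) := fun h => h₁ (congrArg Prod.snd h).subset
  have hrS : r i ∈ S ∧ t ∉ S := by_contra fun h => hS.ne' (hy.supp (i, S) h)
  have hrT : r j ∈ T ∧ t ∉ T := by_contra fun h => hT.ne' (hy.supp (j, T) h)
  have hlt := weight_inter_add_weight_union_lt h₁ h₂
  by_cases hi : r i ∈ T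
  · have := hy.weight_le_of_exchange hmin hne hS hT (S' := S ∩ T) (T' := S ∪ T)
      (by simp [hrS, hi]) (by simp [hrS, hrT]) fun u v => cut_inter_add_cut_union_le u v S T
    linarith
  · by_cases hj : r j ∈ S
    · have := hy.weight_le_of_exchange hmin hne hS hT (S' := S ∪ T) (T' := S ∩ T)
        (by simp [hrS, hrT]) (by simp [hrT, hj])
        fun u v => (add_comm _ _).trans_le (cut_inter_add_cut_union_le u v S T)
      linarith
    · have := hy.weight_le_of_exchange hmin hne hS hT (S' := S \ T) (T' := T \ S)
        (by simp [hrS, hi]) (by simp [hrT, hj]) fun u v => cut_sdiff_add_cut_sdiff_le u v S T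
      have := weight_sdiff_lt h₃
      have := weight_sdiff_lt fun h => h₃ (disjoint_comm.1 h)
      linarith

/-- The layer-cake decomposition of a `[0, 1]`-valued function into superlevel sets. -/
lemma exists_layers (x : V → ℝ) :
    ∃ z : Finset V → ℝ, (∀ S, 0 ≤ z S) ∧ ∑ S, z S = 1 ∧
      (∀ S, z S ≠ 0 → ∀ v, (x v = 0 → v ∉ S) ∧ (1 ≤ x v → v ∈ S)) ∧
      ∀ u v, ∑ S, z S * cut u v S ≤ |x u - x v| := by
  classical
  let level : ℝ → Finset V := fun θ => {v | θ < x v}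
  have hmem : ∀ θ v, v ∈ level θ ↔ θ < x v := fun θ v => by simp [level]
  let μ : MeasureTheory.Measure ℝ := MeasureTheory.volume.restrict (Set.Ico 0 1)
  have hfin : MeasureTheory.IsFiniteMeasure μ := ⟨by simp [μ]⟩
  have hmeas : ∀ S : Finset V, MeasurableSet {θ | level θ = S} := by
    intro S
    have : {θ | level θ = S} = ⋂ v, {θ | θ < x v ↔ v ∈ S} := by
      ext θ; simp [Finset.ext_iff, hmem]
    rw [this]
    refine MeasurableSet.iInter fun v => ?_
    by_cases hv : v ∈ S
    · simp only [hv, iff_true]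
      exact measurableSet_Iio
    · simp only [hv, iff_false, not_lt]
      exact measurableSet_Ici
  have hsum : ∀ P : Finset (Finset V),
      ∑ S ∈ P, μ.real {θ | level θ = S} = μ.real {θ | level θ ∈ P} := by
    intro P
    rw [← MeasureTheory.measureReal_biUnion_finset]
    · congr 1; ext θ; simp
    · intro S _ T _ hST
      exact Set.disjoint_left.2 fun θ (h : _ = _) (h' : _ = _) => hST (h.symm.trans h')
    · exact fun S _ => hmeas S
  refine ⟨fun S => μ.real {θ | level θ = S}, fun S => MeasureTheory.measureReal_nonneg, ?_, ?_, ?_⟩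
  · rw [hsum]; simp [μ, MeasureTheory.measureReal_def]
  · intro S hS v
    have : ({θ | level θ = S} ∩ Set.Ico 0 1).Nonempty := by
      by_contra h
      apply hS
      rw [Set.not_nonempty_iff_eq_empty] at h
      simp [μ, MeasureTheory.measureReal_def, MeasureTheory.Measure.restrict_apply (hmeas S), h]
    obtain ⟨θ, rfl, hθ0, hθ1⟩ := this
    rw [hmem]
    exact ⟨fun h => by linarith, fun h => by linarith⟩
  · intro u v
    have h1 : ∑ S, μ.real {θ | level θ = S} * cut u v S =
        ∑ S with ¬(u ∈ S ↔ v ∈ S), μ.real {θ | level θ = S} := by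
      rw [sum_filter]
      refine sum_congr rfl fun S _ => ?_
      simp only [cut]; split_ifs <;> simp_all
    rw [h1, hsum]
    have h2 : {θ | level θ ∈ ({S | ¬(u ∈ S ↔ v ∈ S)} : Finset (Finset V))} ⊆
        Set.Ico (min (x u) (x v)) (max (x u) (x v)) := by
      intro θ
      simp only [mem_filter, mem_univ, true_and, hmem, Set.mem_ofPred_eq, Set.mem_Ico, min_le_iff,
        lt_max_iff]
      rw [← not_lt, ← not_lt]
      tauto
    calc _ ≤ μ.real (Set.Ico (min (x u) (x v)) (max (x u) (x v))) :=
          MeasureTheory.measureReal_mono h2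
      _ ≤ MeasureTheory.volume.real (Set.Ico (min (x u) (x v)) (max (x u) (x v))) :=
          ENNReal.toReal_mono (by simp) (MeasureTheory.Measure.restrict_apply_le _ _)
      _ = |x u - x v| := by
          rw [Real.volume_real_Ico_of_le min_le_max, max_sub_min_eq_abs']

lemma exists_fracPacking (r : ι → V) (t : V) (d : ι → V → V → ℝ)
    (hdrefl : ∀ a u, d a u u = 0) (hdsymm : ∀ a u v, d a u v = d a v u)
    (hdtri : ∀ a u v w, d a u v ≤ d a u w + d a w v) (hsep : ∀ a, 1 ≤ d a (r a) t) :
    ∃ y, FracPacking r t (fun u v => ∑ a, d a u v) y := by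
  choose z hz0 hz1 hzs hzc using fun a => exists_layers fun v => d a v t
  refine ⟨fun p => z p.1 p.2, fun p => hz0 _ _, hz1, fun p hp => ?_, fun u v => ?_⟩
  · by_contra h
    have := hzs _ _ h
    exact hp ⟨(this (r p.1)).2 (hsep _), (this t).1 (hdrefl _ _)⟩
  · rw [Fintype.sum_prod_type]
    refine sum_le_sum fun a _ => (hzc a u v).trans (abs_sub_le_iff.2 ⟨?_, ?_⟩)
    · linarith [hdtri a u t v]
    · linarith [hdtri a v t u, hdsymm a u v]

/-- Every fractional common-sink cut packing can be rounded, increasing each load by at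
most `2`. -/
theorem FracPacking.exists_cuts (hrt : ∀ a, r a ≠ t) (h : FracPacking r t b y) :
    ∃ A : ι → Finset V, (∀ a, r a ∈ A a ∧ t ∉ A a) ∧
      ∀ u v, (#{a | ¬(u ∈ A a ↔ v ∈ A a)} : ℝ) ≤ b u v + 2 := by
  classical
  obtain ⟨x, hx, hmin⟩ := (isCompact_fracPacking r t b).exists_isMinOn ⟨y, h⟩
    (f := fun y => ∑ p, y p * weight p.2) (by fun_prop)
  replace hmin : ∀ y', FracPacking r t b y' → ∑ p, x p * weight p.2 ≤ ∑ p, y' p * weight p.2 :=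
    fun y' hy' => hmin hy'
  replace hx : FracPacking r t b x := hx
  let F : Finset (Finset V) := {S | ∃ a, 0 < x (a, S)}
  let Y : Finset V → ℝ := fun S => ∑ a, x (a, S)
  have hF : ∀ S, S ∈ F ↔ ∃ a, 0 < x (a, S) := fun S => by simp [F]
  have hsupp : ∀ {a S}, 0 < x (a, S) → r a ∈ S ∧ t ∉ S := fun {a S} hS =>
    by_contra fun h => hS.ne' (hx.supp (a, S) h)
  have hY : ∀ S, 0 ≤ Y S := fun S => sum_nonneg fun a _ => hx.nonneg _
  have hYF : ∀ S, S ∉ F → Y S = 0 := fun S hS => sum_eq_zero fun a _ =>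
    le_antisymm (not_lt.1 fun h => hS ((hF S).2 ⟨a, h⟩)) (hx.nonneg _)
  have hlam : Laminar F := by
    intro S hS T hT
    obtain ⟨i, hi⟩ := (hF S).1 hS
    obtain ⟨j, hj⟩ := (hF T).1 hT
    exact hx.nested_or_disjoint hmin hi hj
  have hall : ∀ S ∈ F, ∑ T ∈ F with T ⊆ S, Y T ≤ #{a | r a ∈ S} := by
    intro S _
    rw [sum_comm, card_filter, Nat.cast_sum]
    refine sum_le_sum fun a _ => ?_
    split_ifs with ha
    · rw [Nat.cast_one, ← hx.sum_eq a]
      exact sum_le_sum_of_subset_of_nonneg (subset_univ _) fun _ _ _ => hx.nonneg _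
    · refine (sum_eq_zero fun T hT => ?_).trans_le (Nat.cast_nonneg _)
      exact hx.supp _ fun h => ha ((mem_filter.1 hT).2 h.1)
  have htot : ∑ T ∈ F, Y T = Fintype.card ι := by
    rw [sum_subset (subset_univ F) fun S _ => hYF S, sum_comm]
    simp [hx.sum_eq]
  obtain ⟨A, hA, hload⟩ := hlam.exists_cuts (X := univ.erase t) hY
    (fun T hT => by
      obtain ⟨a, ha⟩ := (hF T).1 hT
      exact subset_erase.2 ⟨subset_univ _, (hsupp ha).2⟩)
    (fun T hT => by
      obtain ⟨a, ha⟩ := (hF T).1 hT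
      exact ⟨_, (hsupp ha).1⟩)
    (fun a => mem_erase.2 ⟨hrt a, mem_univ _⟩) hall htot
  refine ⟨A, fun a => ⟨(hA a).1, fun ht => notMem_erase t univ ((hA a).2 ht)⟩, fun u v => ?_⟩
  have hb : ∑ T ∈ F with u ∈ T ∧ v ∉ T, Y T + ∑ T ∈ F with v ∈ T ∧ u ∉ T, Y T ≤ b u v := by
    refine le_trans (le_of_eq ?_) (hx.load u v)
    have hsum : ∀ (P : Finset V → Prop) [DecidablePred P],
        ∑ T ∈ F with P T, Y T = ∑ T, if P T then Y T else 0 := fun P _ => by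
      rw [sum_filter (s := F)]
      exact sum_subset (subset_univ F) fun S _ hS => by simp [hYF S hS]
    rw [hsum, hsum, ← sum_add_distrib, Fintype.sum_prod_type_right]
    refine sum_congr rfl fun S _ => ?_
    by_cases h1 : u ∈ S <;> by_cases h2 : v ∈ S <;> simp [cut, h1, h2, Y]
  have hcard : #{a | ¬(u ∈ A a ↔ v ∈ A a)} ≤
      #{a | u ∈ A a ∧ v ∉ A a} + #{a | v ∈ A a ∧ u ∉ A a} := by
    refine (card_le_card fun a => ?_).trans (card_union_le _ _)
    simp only [mem_filter, mem_univ, true_and, mem_union]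
    tauto
  have hcard' : (#{a | ¬(u ∈ A a ↔ v ∈ A a)} : ℝ) ≤
      #{a | u ∈ A a ∧ v ∉ A a} + #{a | v ∈ A a ∧ u ∉ A a} := by exact_mod_cast hcard
  linarith [hload u v, hload v u]

end Fractional

end CutPacking

/-- **Common-sink s-t cut packing, main theorem.**
Given a finite simple graph `G` with positive integer edge capacities `c`, a
sink `t` and sources `r 0, …, r (k-1)` (each distinct from `t`), if the
instance admits a feasible LP solution `d`, then there are vertex sets
`A a ∋ r a` with `t ∉ A a` such that every edge `{u,v}` crosses at most
`c {u,v} + 2` of the cuts `δ(A a)`. -/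
theorem cscp_main
    {V : Type} [Fintype V] [DecidableEq V]
    (G : SimpleGraph V) [DecidableRel G.Adj]
    (c : Sym2 V → ℕ) (hc : ∀ e ∈ G.edgeSet, 0 < c e)
    (t : V) (k : ℕ) (r : Fin k → V) (hrt : ∀ a, r a ≠ t)
    (d : Fin k → V → V → ℝ)
    (hd0 : ∀ a u v, 0 ≤ d a u v) (hd1 : ∀ a u v, d a u v ≤ 1)
    (hdrefl : ∀ a u, d a u u = 0)
    (hdsymm : ∀ a u v, d a u v = d a v u)
    (hdtri : ∀ a u v w, d a u v ≤ d a u w + d a w v)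
    (hsep : ∀ a, 1 ≤ d a (r a) t)
    (hcap : ∀ u v, G.Adj u v → ∑ a, d a u v ≤ (c s(u, v) : ℝ)) :
    ∃ A : Fin k → Finset V,
      (∀ a, r a ∈ A a ∧ t ∉ A a) ∧
      (∀ u v, G.Adj u v →
        (univ.filter fun a => ¬((u ∈ A a) ↔ (v ∈ A a))).card
          ≤ c s(u, v) + 2) := by
  obtain ⟨y, hy⟩ := CutPacking.exists_fracPacking r t d hdrefl hdsymm hdtri hsep
  obtain ⟨A, hA, hload⟩ := hy.exists_cuts hrt
  refine ⟨A, hA, fun u v huv => ?_⟩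
  have h := (hload u v).trans (add_le_add_left (hcap u v huv) 2)
  exact_mod_cast h
end

section
/- Let G=(V,E) be a finite simple undirected graph with positive integer edge capacities c_e, a sink vertex t, and source terminals at vertices r_1,…,r_k with r_a ≠ t. Suppose there exist functions d_a : V×V → [0,1] for a=1,…,k with d_a(u,u)=0, d_a(u,v)=d_a(v,u), d_a(u,v) ≤ d_a(u,w)+d_a(w,v) for all u,v,w, d_a(r_a,t) ≥ 1 for each a, and Σ_a d_a(u,v) ≤ c_e for every edge e={u,v}. Then for every ε > 0 there exists a fractional laminar cut family for the terminals {1,…,k} such that no cut in the family contains t, and whose load on every edge e is at most c_e + ε. -/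
open Finset

/-- A fractional laminar cut family for a terminal set `T` (terminal `i`
located at vertex `r i`): a finite indexed family of cuts (subsets of `V`)
with positive weights, each cut owned by a terminal, such that the collection
of cuts is laminar, every cut owned by `i` contains `r i`, and the weights of
the cuts owned by each terminal sum to `1`. -/
structure FracLaminarFamily (V T : Type) [DecidableEq V] [Fintype T]
    [DecidableEq T] (r : T → V) where
  n : ℕ
  cut : Fin n → Finset V
  wt : Fin n → ℝ
  owner : Fin n → T
  wt_pos : ∀ j, 0 < wt j
  laminar : ∀ j j', (cut j ∩ cut j').Nonempty → cut j ⊆ cut j' ∨ cut j' ⊆ cut j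
  root_mem : ∀ j, r (owner j) ∈ cut j
  wt_sum : ∀ i : T, ∑ j ∈ univ.filter (fun j => owner j = i), wt j = 1

/-- The load of a fractional laminar cut family on the pair (edge) `{u, v}`:
the total weight of the cuts containing exactly one of `u` and `v`. -/
noncomputable def FracLaminarFamily.load {V T : Type} [DecidableEq V]
    [Fintype T] [DecidableEq T] {r : T → V} (F : FracLaminarFamily V T r)
    (u v : V) : ℝ :=
  ∑ j : Fin F.n, if ¬((u ∈ F.cut j) ↔ (v ∈ F.cut j)) then F.wt j else 0

/-- The indicator that `C` separates `u` from `v`. -/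
def cutSep {V : Type} [DecidableEq V] (C : Finset V) (u v : V) : ℝ :=
  if ¬(u ∈ C ↔ v ∈ C) then 1 else 0

/-- A potential that strictly decreases, in total over a pair of crossing sets, under uncrossing. -/
def cutPotential {V : Type} [Fintype V] (C : Finset V) : ℝ :=
  (C.card : ℝ) * (2 * Fintype.card V - C.card)

lemma cutPotential_lt_of_ssubset {V : Type} [Fintype V] {A B : Finset V} (h : A ⊂ B) :
    cutPotential A < cutPotential B := by
  have h1 : (A.card : ℝ) + 1 ≤ B.card := by exact_mod_cast Finset.card_lt_card h
  have h2 : (B.card : ℝ) ≤ Fintype.card V := by exact_mod_cast Finset.card_le_univ B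
  unfold cutPotential
  nlinarith

lemma cutPotential_inter_add_union_lt {V : Type} [Fintype V] [DecidableEq V] {A B : Finset V}
    (hAB : ¬A ⊆ B) (hBA : ¬B ⊆ A) :
    cutPotential (A ∩ B) + cutPotential (A ∪ B) < cutPotential A + cutPotential B := by
  have h1 : ((A ∩ B).card : ℝ) + (A \ B).card = A.card := by
    exact_mod_cast Finset.card_inter_add_card_sdiff A B
  have h2 : ((A ∩ B).card : ℝ) + (B \ A).card = B.card := by
    rw [Finset.inter_comm]
    exact_mod_cast Finset.card_inter_add_card_sdiff B A
  have h3 : ((A ∪ B).card : ℝ) + (A ∩ B).card = A.card + B.card := by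
    exact_mod_cast Finset.card_union_add_card_inter A B
  have h4 : (0 : ℝ) < (A \ B).card := by
    exact_mod_cast Finset.card_pos.2 (Finset.sdiff_nonempty.2 hAB)
  have h5 : (0 : ℝ) < (B \ A).card := by
    exact_mod_cast Finset.card_pos.2 (Finset.sdiff_nonempty.2 hBA)
  have h6 := mul_pos h4 h5
  have h7 : ((A ∪ B).card : ℝ) = (A ∩ B).card + (A \ B).card + (B \ A).card := by linarith
  unfold cutPotential
  rw [h7, ← h1, ← h2]
  nlinarith

lemma cutSep_inter_add_union_le {V : Type} [DecidableEq V] (A B : Finset V) (u v : V) :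
    cutSep (A ∩ B) u v + cutSep (A ∪ B) u v ≤ cutSep A u v + cutSep B u v := by
  unfold cutSep
  by_cases h1 : u ∈ A <;> by_cases h2 : v ∈ A <;> by_cases h3 : u ∈ B <;> by_cases h4 : v ∈ B <;>
    simp [h1, h2, h3, h4]

lemma cutSep_sdiff_add_sdiff_le {V : Type} [DecidableEq V] (A B : Finset V) (u v : V) :
    cutSep (A \ B) u v + cutSep (B \ A) u v ≤ cutSep A u v + cutSep B u v := by
  unfold cutSep
  by_cases h1 : u ∈ A <;> by_cases h2 : v ∈ A <;> by_cases h3 : u ∈ B <;> by_cases h4 : v ∈ B <;>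
    simp [h1, h2, h3, h4]

/-- Two crossing cuts, rooted at `r` and `s` and avoiding `t`, can be uncrossed. -/
lemma exists_uncrossing {V : Type} [Fintype V] [DecidableEq V] {A B : Finset V} {r s t : V}
    (hr : r ∈ A) (hs : s ∈ B) (htA : t ∉ A) (htB : t ∉ B)
    (hne : (A ∩ B).Nonempty) (hAB : ¬A ⊆ B) (hBA : ¬B ⊆ A) :
    ∃ A' B' : Finset V, r ∈ A' ∧ s ∈ B' ∧ t ∉ A' ∧ t ∉ B' ∧
      (∀ u v, cutSep A' u v + cutSep B' u v ≤ cutSep A u v + cutSep B u v) ∧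
      cutPotential A' + cutPotential B' < cutPotential A + cutPotential B := by
  have key := cutPotential_inter_add_union_lt hAB hBA
  by_cases hrB : r ∈ B
  · exact ⟨A ∩ B, A ∪ B, by simp [*], by simp [*], by simp [*], by simp [*],
      cutSep_inter_add_union_le A B, key⟩
  by_cases hsA : s ∈ A
  · exact ⟨A ∪ B, A ∩ B, by simp [*], by simp [*], by simp [*], by simp [*],
      fun u v => by linarith [cutSep_inter_add_union_le A B u v], by linarith⟩
  obtain ⟨x, hx⟩ := hne
  rw [Finset.mem_inter] at hx
  refine ⟨A \ B, B \ A, by simp [*], by simp [*], by simp [*], by simp [*],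
    cutSep_sdiff_add_sdiff_le A B, add_lt_add ?_ ?_⟩
  · refine cutPotential_lt_of_ssubset (Finset.ssubset_iff_subset_ne.2 ⟨Finset.sdiff_subset, ?_⟩)
    exact fun h => (Finset.mem_sdiff.1 (h ▸ hx.1)).2 hx.2
  · refine cutPotential_lt_of_ssubset (Finset.ssubset_iff_subset_ne.2 ⟨Finset.sdiff_subset, ?_⟩)
    exact fun h => (Finset.mem_sdiff.1 (h ▸ hx.2)).2 hx.1

/-- The polytope of fractional (not necessarily laminar) cut families avoiding `t`, encoded as
weightings of terminal-cut pairs, whose load on each edge `uv` of `G` is at most `b u v`. -/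
def cutPolytope {V T : Type} [Fintype V] [DecidableEq V] [Fintype T] [DecidableEq T]
    (G : SimpleGraph V) (b : V → V → ℝ) (t : V) (r : T → V) : Set (T × Finset V → ℝ) :=
  {x | (∀ p, 0 ≤ x p) ∧ (∀ p, ¬(r p.1 ∈ p.2 ∧ t ∉ p.2) → x p = 0) ∧
    (∀ i, ∑ p, x p * (if p.1 = i then 1 else 0) = 1) ∧
    ∀ u v, G.Adj u v → ∑ p, x p * cutSep p.2 u v ≤ b u v}

lemma isCompact_cutPolytope {V T : Type} [Fintype V] [DecidableEq V] [Fintype T] [DecidableEq T]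
    (G : SimpleGraph V) (b : V → V → ℝ) (t : V) (r : T → V) :
    IsCompact (cutPolytope G b t r) := by
  refine (isCompact_Icc (a := (0 : T × Finset V → ℝ)) (b := 1)).of_isClosed_subset ?_ ?_
  · simp only [cutPolytope, Set.ofPred_and, Set.ofPred_forall]
    refine IsClosed.inter ?_ (IsClosed.inter ?_ (IsClosed.inter ?_ ?_))
    · exact isClosed_iInter fun p => isClosed_le (by fun_prop) (by fun_prop)
    · exact isClosed_iInter fun p => isClosed_iInter fun _ =>
        isClosed_eq (by fun_prop) (by fun_prop)
    · exact isClosed_iInter fun i => isClosed_eq (by fun_prop) (by fun_prop)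
    · exact isClosed_iInter fun u => isClosed_iInter fun v => isClosed_iInter fun _ =>
        isClosed_le (by fun_prop) (by fun_prop)
  · rintro x ⟨h0, -, h1, -⟩
    refine ⟨h0, fun p => ?_⟩
    have := Finset.single_le_sum (f := fun q => x q * (if q.1 = p.1 then (1 : ℝ) else 0))
      (fun q _ => mul_nonneg (h0 q) (by split_ifs <;> norm_num)) (Finset.mem_univ p)
    rw [h1 p.1] at this
    simpa using this

/-- A potential-minimal point of the cut polytope has laminar support. -/
lemma laminar_of_isMinOn_cutPolytope {V T : Type} [Fintype V] [DecidableEq V] [Fintype T]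
    [DecidableEq T] {G : SimpleGraph V} {b : V → V → ℝ} {t : V} {r : T → V}
    {x : T × Finset V → ℝ} (hx : x ∈ cutPolytope G b t r)
    (hmin : IsMinOn (fun y : T × Finset V → ℝ => ∑ p, y p * cutPotential p.2)
      (cutPolytope G b t r) x)
    {p q : T × Finset V} (hp : 0 < x p) (hq : 0 < x q) (hne : (p.2 ∩ q.2).Nonempty) :
    p.2 ⊆ q.2 ∨ q.2 ⊆ p.2 := by
  by_contra! h
  obtain ⟨hpq, hqp⟩ := h
  obtain ⟨h0, hbad, hsum, hload⟩ := hx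
  have hgp := not_imp_comm.1 (hbad p) hp.ne'
  have hgq := not_imp_comm.1 (hbad q) hq.ne'
  obtain ⟨A, B, hrA, hsB, htA, htB, hsep, hpot⟩ :=
    exists_uncrossing hgp.1 hgq.1 hgp.2 hgq.2 hne hpq hqp
  have hpne : p ≠ q := fun h => hpq (h ▸ subset_rfl)
  set w := min (x p) (x q) with hw
  have hwpos : 0 < w := lt_min hp hq
  set y : T × Finset V → ℝ := fun z => x z + w * ((if z = (p.1, A) then 1 else 0) +
    (if z = (q.1, B) then 1 else 0) - (if z = p then 1 else 0) - (if z = q then 1 else 0)) with hy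
  have hlin : ∀ g : T × Finset V → ℝ, ∑ z, y z * g z =
      ∑ z, x z * g z + w * (g (p.1, A) + g (q.1, B) - g p - g q) := by
    intro g
    simp only [hy, add_mul, mul_assoc, sub_mul, Finset.sum_add_distrib, ← Finset.mul_sum,
      Finset.sum_sub_distrib, ite_mul, one_mul, zero_mul, Finset.sum_ite_eq', Finset.mem_univ,
      if_true]
  have hymem : y ∈ cutPolytope G b t r := by
    refine ⟨fun z => ?_, fun z hz => ?_, fun i => ?_, fun u v huv => ?_⟩
    · have h1 : (0 : ℝ) ≤ w * (if z = (p.1, A) then 1 else 0) := by positivity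
      have h2 : (0 : ℝ) ≤ w * (if z = (q.1, B) then 1 else 0) := by positivity
      have h3 : w * (if z = p then 1 else 0) + w * (if z = q then 1 else 0) ≤ x z := by
        by_cases hzp : z = p
        · have hzq : z ≠ q := hzp ▸ hpne
          simp [hzp, hpne, hw]
        · by_cases hzq : z = q
          · simp [hzq, hpne.symm, hw]
          · simpa [hzp, hzq] using h0 z
      simp only [hy]
      linarith
    · have hz1 : z ≠ (p.1, A) := by rintro rfl; exact hz ⟨hrA, htA⟩
      have hz2 : z ≠ (q.1, B) := by rintro rfl; exact hz ⟨hsB, htB⟩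
      have hz3 : z ≠ p := by rintro rfl; exact hz hgp
      have hz4 : z ≠ q := by rintro rfl; exact hz hgq
      simp [hy, hz1, hz2, hz3, hz4, hbad z hz]
    · rw [hlin fun z => if z.1 = i then 1 else 0, hsum i]
      ring
    · rw [hlin fun z => cutSep z.2 u v]
      nlinarith [hload u v huv, hsep u v]
  have hle : ∑ z, x z * cutPotential z.2 ≤ ∑ z, y z * cutPotential z.2 := hmin hymem
  rw [hlin fun z => cutPotential z.2] at hle
  nlinarith

/-- A function `f` with values `0` at `s` and `1` at `t` induces, through its sublevel sets, a
probability weighting of the `s`-`t` cuts that loads each pair `u v` by at most `|f u - f v|`. -/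
lemma exists_sublevel_cut_weights {V : Type} [Fintype V] [DecidableEq V] (f : V → ℝ) {s t : V}
    (hs : f s = 0) (ht : f t = 1) :
    ∃ y : Finset V → ℝ, (∀ C, 0 ≤ y C) ∧ (∀ C, ¬(s ∈ C ∧ t ∉ C) → y C = 0) ∧
      ∑ C, y C = 1 ∧ ∀ u v, ∑ C, y C * cutSep C u v ≤ |f u - f v| := by
  classical
  let S : Finset V → Set ℝ := fun C => {θ | ∀ v, f v < θ ↔ v ∈ C} ∩ Set.Ioc 0 1
  have hSm : ∀ C, MeasurableSet (S C) := by
    intro C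
    refine MeasurableSet.inter ?_ measurableSet_Ioc
    rw [Set.ofPred_forall]
    refine MeasurableSet.iInter fun v => ?_
    by_cases hv : v ∈ C
    · simp only [hv, iff_true]
      exact measurableSet_Ioi
    · simp only [hv, iff_false, not_lt]
      exact measurableSet_Iic
  have hSfin : ∀ C, MeasureTheory.volume (S C) ≠ ⊤ := fun C =>
    MeasureTheory.measure_ne_top_of_subset Set.inter_subset_right (by simp)
  have hdisj : ∀ F : Finset (Finset V), Set.PairwiseDisjoint (F : Set (Finset V)) S := by
    intro F C _ D _ hCD
    refine Set.disjoint_left.2 fun θ hC hD => hCD ?_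
    ext v
    rw [← hC.1 v, ← hD.1 v]
  have hsum : ∀ F : Finset (Finset V), ∑ C ∈ F, MeasureTheory.volume.real (S C) =
      MeasureTheory.volume.real (⋃ C ∈ F, S C) := fun F =>
    (MeasureTheory.measureReal_biUnion_finset (hdisj F) (fun C _ => hSm C)
      (fun C _ => hSfin C)).symm
  refine ⟨fun C => MeasureTheory.volume.real (S C), fun C => MeasureTheory.measureReal_nonneg,
    fun C hC => ?_, ?_, fun u v => ?_⟩
  · have : S C = ∅ := by
      refine Set.eq_empty_of_forall_notMem fun θ hθ => hC ⟨?_, ?_⟩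
      · rw [← hθ.1 s, hs]
        exact hθ.2.1
      · rw [← hθ.1 t, ht]
        exact not_lt.2 hθ.2.2
    simp [this]
  · rw [hsum]
    have : (⋃ C ∈ (Finset.univ : Finset (Finset V)), S C) = Set.Ioc 0 1 := by
      ext θ
      simp only [Finset.mem_univ, Set.iUnion_true, Set.mem_iUnion]
      exact ⟨fun ⟨C, hC⟩ => hC.2,
        fun h => ⟨Finset.univ.filter fun v => f v < θ, fun v => by simp, h⟩⟩
    rw [this]
    simp
  · simp only [cutSep, mul_ite, mul_one, mul_zero]
    rw [← Finset.sum_filter, hsum]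
    calc _ ≤ MeasureTheory.volume.real (Set.uIoc (f v) (f u)) := by
          refine MeasureTheory.measureReal_mono ?_ (by simp)
          intro θ hθ
          simp only [Finset.mem_filter, Finset.mem_univ, true_and, Set.mem_iUnion] at hθ
          obtain ⟨C, hC, hθ⟩ := hθ
          rw [← hθ.1 u, ← hθ.1 v] at hC
          rw [Set.mem_uIoc]
          by_contra! hcon
          apply hC
          constructor
          · intro h
            by_contra h'
            exact absurd (hcon.2 h) (by linarith)
          · intro h
            by_contra h'
            exact absurd (hcon.1 h) (by linarith)
      _ = |f u - f v| := by
          simp [MeasureTheory.measureReal_def, Set.uIoc, max_sub_min_eq_abs]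

/-- A weighting in the cut polytope with laminar support is a fractional laminar cut family. -/
lemma exists_fracLaminarFamily_of_mem_cutPolytope {V T : Type} [Fintype V] [DecidableEq V]
    [Fintype T] [DecidableEq T] {G : SimpleGraph V} {b : V → V → ℝ} {t : V} {r : T → V}
    {x : T × Finset V → ℝ} (hx : x ∈ cutPolytope G b t r)
    (hlam : ∀ p q, 0 < x p → 0 < x q → (p.2 ∩ q.2).Nonempty → p.2 ⊆ q.2 ∨ q.2 ⊆ p.2) :
    ∃ F : FracLaminarFamily V T r, (∀ j, t ∉ F.cut j) ∧
      ∀ u v, G.Adj u v → F.load u v ≤ b u v := by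
  classical
  obtain ⟨h0, hbad, hsum, hload⟩ := hx
  let e := Fintype.equivFin {p // 0 < x p}
  have hgood : ∀ p : {p // 0 < x p}, r p.1.1 ∈ p.1.2 ∧ t ∉ p.1.2 := fun p =>
    not_imp_comm.1 (hbad p.1) p.2.ne'
  have htrans : ∀ g : T × Finset V → ℝ,
      ∑ j, x (e.symm j).1 * g (e.symm j).1 = ∑ p, x p * g p := by
    intro g
    rw [e.symm.sum_comp (fun p => x p.1 * g p.1),
      ← Finset.sum_subtype (Finset.univ.filter fun p => 0 < x p) (by simp) (fun p => x p * g p)]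
    refine Finset.sum_subset (Finset.subset_univ _) fun p _ hp => ?_
    have : x p = 0 := le_antisymm (by simpa using hp) (h0 p)
    simp [this]
  refine ⟨⟨_, fun j => (e.symm j).1.2, fun j => x (e.symm j).1, fun j => (e.symm j).1.1,
    fun j => (e.symm j).2, fun j j' => hlam _ _ (e.symm j).2 (e.symm j').2,
    fun j => (hgood _).1, fun i => ?_⟩, fun j => (hgood _).2, fun u v huv => ?_⟩
  · rw [← hsum i, ← htrans fun p => if p.1 = i then 1 else 0, Finset.sum_filter]
    simp
  · refine le_trans (le_of_eq ?_) (hload u v huv)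
    rw [← htrans fun p => cutSep p.2 u v]
    simp [FracLaminarFamily.load, cutSep]

/-- **Laminarization for the common-sink case (Lemma `Lam-1`).**
Given a feasible LP solution `d` for a CSCP instance with sink `t`, sources
`r 0, …, r (k-1)` and positive integer capacities `c`, for every `ε > 0` there
is a fractional laminar cut family for the terminals whose cuts all avoid `t`
and whose load on every edge `e` is at most `c e + ε`. -/
theorem cscp_laminarization
    {V : Type} [Fintype V] [DecidableEq V]
    (G : SimpleGraph V) [DecidableRel G.Adj]
    (c : Sym2 V → ℕ) (hc : ∀ e ∈ G.edgeSet, 0 < c e)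
    (t : V) (k : ℕ) (r : Fin k → V) (hrt : ∀ a, r a ≠ t)
    (d : Fin k → V → V → ℝ)
    (hd0 : ∀ a u v, 0 ≤ d a u v) (hd1 : ∀ a u v, d a u v ≤ 1)
    (hdrefl : ∀ a u, d a u u = 0)
    (hdsymm : ∀ a u v, d a u v = d a v u)
    (hdtri : ∀ a u v w, d a u v ≤ d a u w + d a w v)
    (hsep : ∀ a, 1 ≤ d a (r a) t)
    (hcap : ∀ u v, G.Adj u v → ∑ a, d a u v ≤ (c s(u, v) : ℝ)) :
    ∀ ε : ℝ, 0 < ε →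
      ∃ F : FracLaminarFamily V (Fin k) r,
        (∀ j, t ∉ F.cut j) ∧
        (∀ u v, G.Adj u v → F.load u v ≤ (c s(u, v) : ℝ) + ε) := by
  intro ε hε
  choose y hy0 hybad hysum hyload using fun a =>
    exists_sublevel_cut_weights (d a (r a)) (hdrefl a (r a)) (le_antisymm (hd1 a _ _) (hsep a))
  have hmem : (fun p : Fin k × Finset V => y p.1 p.2) ∈
      cutPolytope G (fun u v => (c s(u, v) : ℝ)) t r := by
    refine ⟨fun p => hy0 _ _, fun p hp => hybad _ _ hp, fun i => ?_, fun u v huv => ?_⟩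
    · simp [Fintype.sum_prod_type, hysum]
    · rw [Fintype.sum_prod_type]
      refine (Finset.sum_le_sum fun a _ => (hyload a u v).trans ?_).trans (hcap u v huv)
      rw [abs_le]
      constructor
      · linarith [hdtri a (r a) v u]
      · linarith [hdtri a (r a) u v, hdsymm a u v]
  obtain ⟨x, hx, hmin⟩ := (isCompact_cutPolytope G (fun u v => (c s(u, v) : ℝ)) t r).exists_isMinOn
    ⟨_, hmem⟩ (f := fun x => ∑ p, x p * cutPotential p.2) (by fun_prop)
  obtain ⟨F, hFt, hF⟩ := exists_fracLaminarFamily_of_mem_cutPolytope hx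
    fun p q hp hq => laminar_of_isMinOn_cutPolytope hx hmin hp hq
  exact ⟨F, hFt, fun u v huv => (hF u v huv).trans (by linarith)⟩
end
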